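/- arXiv:1203.4972 — 2 statements merged into one kernel-verified Lean document; each statement's English description precedes it below -/
import Mathlib

section
/- Let f be a nonzero binary form of degree n and s = l(f) its length, with 2s ≤ n+1. Then dim (Ann(f))_s = 1, say (Ann(f))_s = ⟨α⟩, and for every integer v with s ≤ v ≤ n - s + 1 one has (Ann(f))_v = T_{v-s} · α. -/
open MvPolynomial

noncomputable def contractOp (φ f : MvPolynomial (Fin 2) ℂ) : MvPolynomial (Fin 2) ℂ :=
  φ.support.sum fun m =>
    φ.coeff m • ((fun p => pderiv (0 : Fin 2) p)^[m 0]
      ((fun p => pderiv (1 : Fin 2) p)^[m 1] f))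

def IsLinearForm (L : MvPolynomial (Fin 2) ℂ) : Prop := L ≠ 0 ∧ L.IsHomogeneous 1

def Proportional (L L' : MvPolynomial (Fin 2) ℂ) : Prop := ∃ c : ℂ, L' = c • L

def IsGAD (n : ℕ) (f : MvPolynomial (Fin 2) ℂ) (m : ℕ)
    (L : Fin m → MvPolynomial (Fin 2) ℂ) (g : Fin m → ℕ)
    (G : Fin m → MvPolynomial (Fin 2) ℂ) : Prop :=
  (∀ i, IsLinearForm (L i)) ∧
  (∀ i j, i ≠ j → ¬ Proportional (L i) (L j)) ∧
  (∀ i, 1 ≤ g i) ∧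
  (∀ i, (G i).IsHomogeneous (g i - 1)) ∧
  f = ∑ i, G i * (L i) ^ (n - g i + 1)

def HasGADLength (n : ℕ) (f : MvPolynomial (Fin 2) ℂ) (s : ℕ) : Prop :=
  ∃ m L g G, IsGAD n f m L g G ∧ ∑ i, g i = s

/-- The derivation `a ∂₀ + b ∂₁`. -/
noncomputable def dirDeriv (a b : ℂ) :
    Derivation ℂ (MvPolynomial (Fin 2) ℂ) (MvPolynomial (Fin 2) ℂ) :=
  a • pderiv 0 + b • pderiv 1

/-- The linear form `a x₀ + b x₁`. -/
noncomputable def linForm (a b : ℂ) : MvPolynomial (Fin 2) ℂ := C a * X 0 + C b * X 1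

lemma pderiv_commute {R σ : Type*} [CommSemiring R] (i j : σ) (p : MvPolynomial σ R) :
    pderiv i (pderiv j p) = pderiv j (pderiv i p) := by
  classical
  ext m
  simp only [coeff_pderiv]
  rcases eq_or_ne i j with rfl | h
  · rfl
  · rw [add_right_comm m]
    simp [h, h.symm]
    ring

lemma contractOp_eq_sum (φ f : MvPolynomial (Fin 2) ℂ) :
    contractOp φ f = (AddMonoidAlgebra.coeff φ).sum fun m c =>
      c • ((pderiv (0 : Fin 2)).toLinearMap ^ m 0 * (pderiv (1 : Fin 2)).toLinearMap ^ m 1 :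
        Module.End ℂ (MvPolynomial (Fin 2) ℂ)) f := by
  simp only [contractOp, MvPolynomial.sum_def, Module.End.mul_apply, Module.End.pow_apply]
  rfl

lemma contractOp_add_left (φ ψ f : MvPolynomial (Fin 2) ℂ) :
    contractOp (φ + ψ) f = contractOp φ f + contractOp ψ f := by
  simp only [contractOp_eq_sum, AddMonoidAlgebra.coeff_add]
  exact Finsupp.sum_add_index' (by simp) (by intros; rw [add_smul])

lemma contractOp_monomial (m : Fin 2 →₀ ℕ) (c : ℂ) (f : MvPolynomial (Fin 2) ℂ) :
    contractOp (monomial m c) f =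
      c • ((pderiv (0 : Fin 2)).toLinearMap ^ m 0 * (pderiv (1 : Fin 2)).toLinearMap ^ m 1 :
        Module.End ℂ (MvPolynomial (Fin 2) ℂ)) f := by
  rw [contractOp_eq_sum]
  exact Finsupp.sum_single_index (by simp)

lemma contractOp_add_right (φ f g : MvPolynomial (Fin 2) ℂ) :
    contractOp φ (f + g) = contractOp φ f + contractOp φ g := by
  simp only [contractOp_eq_sum, map_add, smul_add]
  exact Finsupp.sum_add

lemma contractOp_zero_right (φ : MvPolynomial (Fin 2) ℂ) : contractOp φ 0 = 0 := by
  simp [contractOp_eq_sum]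

lemma contractOp_sum_right {ι : Type*} (s : Finset ι) (φ : MvPolynomial (Fin 2) ℂ)
    (f : ι → MvPolynomial (Fin 2) ℂ) :
    contractOp φ (∑ i ∈ s, f i) = ∑ i ∈ s, contractOp φ (f i) := by
  classical
  induction s using Finset.induction_on with
  | empty => simp [contractOp_zero_right]
  | insert i s hi ih => rw [Finset.sum_insert hi, Finset.sum_insert hi, contractOp_add_right, ih]

lemma contractOp_mul (φ ψ f : MvPolynomial (Fin 2) ℂ) :
    contractOp (φ * ψ) f = contractOp φ (contractOp ψ f) := by
  have hcomm : Commute (pderiv (0 : Fin 2)).toLinearMap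
      ((pderiv (1 : Fin 2)).toLinearMap : Module.End ℂ (MvPolynomial (Fin 2) ℂ)) :=
    LinearMap.ext fun p => pderiv_commute 0 1 p
  induction φ using MvPolynomial.induction_on' with
  | add p q hp hq => rw [add_mul, contractOp_add_left, contractOp_add_left, hp, hq]
  | monomial m c =>
    induction ψ using MvPolynomial.induction_on' with
    | add p q hp hq =>
      rw [mul_add, contractOp_add_left, contractOp_add_left, hp, hq, contractOp_add_right]
    | monomial k d =>
      rw [monomial_mul, contractOp_monomial, contractOp_monomial, contractOp_monomial, map_smul,
        smul_smul, ← Module.End.mul_apply]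
      congr 2
      simp only [Finsupp.add_apply, pow_add]
      rw [mul_assoc, mul_assoc, ← mul_assoc (_ ^ k 0),
        (hcomm.pow_pow (k 0) (m 1)).eq]
      simp only [mul_assoc]

lemma contractOp_C (c : ℂ) (f : MvPolynomial (Fin 2) ℂ) : contractOp (C c) f = c • f := by
  rw [C_apply, contractOp_monomial]
  simp

lemma contractOp_X_zero (f : MvPolynomial (Fin 2) ℂ) : contractOp (X 0) f = pderiv 0 f := by
  rw [X, contractOp_monomial]
  simp

lemma contractOp_X_one (f : MvPolynomial (Fin 2) ℂ) : contractOp (X 1) f = pderiv 1 f := by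
  rw [X, contractOp_monomial]
  simp

lemma contractOp_linForm (a b : ℂ) (f : MvPolynomial (Fin 2) ℂ) :
    contractOp (linForm a b) f = dirDeriv a b f := by
  simp [linForm, dirDeriv, contractOp_add_left, contractOp_mul, contractOp_C, contractOp_X_zero,
    contractOp_X_one]

lemma isHomogeneous_linForm (a b : ℂ) : (linForm a b).IsHomogeneous 1 :=
  (isHomogeneous_C_mul_X a 0).add (isHomogeneous_C_mul_X b 1)

lemma isHomogeneous_smul {f : MvPolynomial (Fin 2) ℂ} {n : ℕ} (hf : f.IsHomogeneous n) (c : ℂ) :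
    (c • f).IsHomogeneous n :=
  (homogeneousSubmodule (Fin 2) ℂ n).smul_mem c hf

lemma isHomogeneous_dirDeriv {f : MvPolynomial (Fin 2) ℂ} {n : ℕ} (hf : f.IsHomogeneous n)
    (a b : ℂ) : (dirDeriv a b f).IsHomogeneous (n - 1) :=
  (isHomogeneous_smul hf.pderiv a).add (isHomogeneous_smul hf.pderiv b)

lemma eq_C_of_isHomogeneous_zero {f : MvPolynomial (Fin 2) ℂ} (hf : f.IsHomogeneous 0) :
    f = C (coeff 0 f) :=
  totalDegree_eq_zero_iff_eq_C.mp ((totalDegree_zero_iff_isHomogeneous _).mpr hf)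

lemma dirDeriv_eq_zero_of_degree_zero {f : MvPolynomial (Fin 2) ℂ} (hf : f.IsHomogeneous 0)
    (a b : ℂ) : dirDeriv a b f = 0 := by
  rw [eq_C_of_isHomogeneous_zero hf, ← algebraMap_eq, Derivation.map_algebraMap]

lemma dirDeriv_linForm (a b p q : ℂ) : dirDeriv a b (linForm p q) = C (a * p + b * q) := by
  simp [dirDeriv, linForm, pderiv_X, smul_eq_C_mul]

lemma linForm_eq_zero_iff {a b : ℂ} : linForm a b = 0 ↔ a = 0 ∧ b = 0 := by
  refine ⟨fun h => ?_, fun h => by simp [linForm, h]⟩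
  have h0 := congrArg (eval ![1, 0]) h
  have h1 := congrArg (eval ![0, 1]) h
  simp [linForm] at h0 h1
  exact ⟨h0, h1⟩

lemma exists_eq_linForm {L : MvPolynomial (Fin 2) ℂ} (hL : L.IsHomogeneous 1) :
    ∃ p q, L = linForm p q := by
  have h := hL.sum_X_mul_pderiv
  have h0 := eq_C_of_isHomogeneous_zero (hL.pderiv (i := 0))
  have h1 := eq_C_of_isHomogeneous_zero (hL.pderiv (i := 1))
  rw [Fin.sum_univ_two, one_smul, h0, h1] at h
  exact ⟨coeff 0 (pderiv 0 L), coeff 0 (pderiv 1 L), by rw [linForm, mul_comm, mul_comm (C _), h]⟩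

lemma linForm_smul (c a b : ℂ) : c • linForm a b = linForm (c * a) (c * b) := by
  simp [linForm, smul_eq_C_mul]; ring

/-- Two vectors annihilated by the same nonzero functional are proportional. -/
lemma exists_linForm_eq_smul {a b p q : ℂ} (hab : a ≠ 0 ∨ b ≠ 0) (h : a * p + b * q = 0) :
    ∃ t : ℂ, linForm p q = t • linForm b (-a) := by
  simp only [linForm_smul]
  rcases hab with ha | hb
  · refine ⟨-q / a, ?_⟩
    congr 1 <;> field_simp
    linear_combination h
  · refine ⟨p / b, ?_⟩
    congr 1 <;> field_simp
    linear_combination h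

lemma isHomogeneous_of_mul {a b : MvPolynomial (Fin 2) ℂ} {i j : ℕ} (ha0 : a ≠ 0)
    (ha : a.IsHomogeneous i) (hab : (a * b).IsHomogeneous (i + j)) : b.IsHomogeneous j := by
  let _ : GradedAlgebra (homogeneousSubmodule (Fin 2) ℂ) := gradedAlgebra
  have h := DirectSum.coe_decompose_mul_add_of_left_mem (homogeneousSubmodule (Fin 2) ℂ)
    (i := i) (j := j) (a := a) (b := b) ha
  rw [DirectSum.decompose_of_mem_same _ hab] at h
  rw [mul_left_cancel₀ ha0 h]
  exact SetLike.coe_mem (DirectSum.decompose (homogeneousSubmodule (Fin 2) ℂ) b j)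

lemma aeval_smul_of_isHomogeneous {A : Type*} [CommRing A] [Algebra ℂ A]
    {f : MvPolynomial (Fin 2) ℂ} {n : ℕ} (hf : f.IsHomogeneous n) (c : Fin 2 → ℂ) (t : A) :
    aeval (fun i => c i • t) f = eval c f • t ^ n := by
  rw [aeval_def, eval₂_eq', eval_eq', Finset.sum_smul]
  refine Finset.sum_congr rfl fun m hm => ?_
  have hdeg := hf.degree_eq_sum_deg_support hm
  have : n = m 0 + m 1 := by
    rw [hdeg, ← Fin.sum_univ_two (fun i => m i)]
    exact Finset.sum_subset (Finset.subset_univ _) (by simp)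
  simp only [Fin.prod_univ_two, this, Algebra.smul_def, mul_pow, map_mul, map_pow, pow_add]
  ring

lemma linForm_dvd_of_eval_eq_zero {f : MvPolynomial (Fin 2) ℂ} {n : ℕ} (hf : f.IsHomogeneous n)
    {p q : ℂ} (hpq : p ≠ 0 ∨ q ≠ 0) (h : eval ![p, q] f = 0) : linForm q (-p) ∣ f := by
  rw [← Ideal.mem_span_singleton, ← Ideal.Quotient.eq_zero_iff_mem]
  set I := Ideal.span {linForm q (-p)} with hI
  have hrel : q • Ideal.Quotient.mkₐ ℂ I (X 0) = p • Ideal.Quotient.mkₐ ℂ I (X 1) := by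
    rw [← map_smul, ← map_smul, Ideal.Quotient.mkₐ_eq_mk, Ideal.Quotient.eq, hI,
      Ideal.mem_span_singleton]
    refine ⟨1, ?_⟩
    simp [linForm, smul_eq_C_mul]
    ring
  obtain ⟨t, ht⟩ : ∃ t, ∀ i, Ideal.Quotient.mkₐ ℂ I (X i) = (![p, q] : Fin 2 → ℂ) i • t := by
    rcases hpq with hp | hq
    · refine ⟨p⁻¹ • Ideal.Quotient.mkₐ ℂ I (X 0), Fin.forall_fin_two.2 ⟨?_, ?_⟩⟩
      · simp [smul_smul, hp]
      · simp only [Matrix.cons_val_one, Matrix.cons_val_fin_one]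
        rw [smul_comm, hrel, smul_smul, inv_mul_cancel₀ hp, one_smul]
    · refine ⟨q⁻¹ • Ideal.Quotient.mkₐ ℂ I (X 1), Fin.forall_fin_two.2 ⟨?_, ?_⟩⟩
      · simp only [Matrix.cons_val_zero]
        rw [smul_comm, ← hrel, smul_smul, inv_mul_cancel₀ hq, one_smul]
      · simp [smul_smul, hq]
  have h1 := aeval_smul_of_isHomogeneous hf ![p, q] t
  rw [h, zero_smul] at h1
  have h2 : Ideal.Quotient.mkₐ ℂ I f = aeval (fun i => (![p, q] : Fin 2 → ℂ) i • t) f := by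
    rw [← funext ht, ← comp_aeval_apply, aeval_X_left_apply]
  rw [← Ideal.Quotient.mkₐ_eq_mk ℂ, h2, h1]

lemma exists_eval_eq_zero {f : MvPolynomial (Fin 2) ℂ} {n : ℕ} (hf : f.IsHomogeneous (n + 1)) :
    ∃ p q, (p ≠ 0 ∨ q ≠ 0) ∧ eval ![p, q] f = 0 := by
  by_contra! hne
  let P : Polynomial ℂ := aeval ![Polynomial.X, 1] f
  have hP (t : ℂ) : P.eval t = eval ![t, 1] f := by
    simp only [P, ← Polynomial.coe_aeval_eq_eval, comp_aeval_apply]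
    rw [← aeval_eq_eval]
    congr 2
    funext i; fin_cases i <;> simp
  have hdeg : P.degree = 0 := by
    by_contra hd
    obtain ⟨t, ht⟩ := IsAlgClosed.exists_root P hd
    exact hne t 1 (by simp) (by rw [← hP]; exact ht)
  obtain ⟨c, hc⟩ : ∃ c, P = Polynomial.C c := ⟨_, Polynomial.eq_C_of_degree_eq_zero hdeg⟩
  have hc' (t : ℂ) : eval ![t, 1] f = c := by rw [← hP, hc, Polynomial.eval_C]
  have hzero : X 1 * (f - C c * X 1 ^ (n + 1)) = 0 := by
    refine MvPolynomial.funext fun x => ?_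
    rcases eq_or_ne (x 1) 0 with h | h
    · simp [h]
    · have hx : x = fun i => (![x 0 / x 1, 1] : Fin 2 → ℂ) i • x 1 := by
        ext i; fin_cases i <;> simp [h]
      have := aeval_smul_of_isHomogeneous hf ![x 0 / x 1, 1] (x 1)
      rw [← hx, hc', aeval_eq_eval] at this
      simp [this]
  have hf' : f = C c * X 1 ^ (n + 1) := by
    simpa [sub_eq_zero] using hzero
  exact hne 1 0 (by simp) (by rw [hf']; simp)

lemma exists_eq_linForm_mul {f : MvPolynomial (Fin 2) ℂ} {n : ℕ} (hf : f.IsHomogeneous (n + 1)) :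
    ∃ a b g, (a ≠ 0 ∨ b ≠ 0) ∧ g.IsHomogeneous n ∧ f = linForm a b * g := by
  obtain ⟨p, q, hpq, h⟩ := exists_eval_eq_zero hf
  obtain ⟨g, rfl⟩ := linForm_dvd_of_eval_eq_zero hf hpq h
  refine ⟨q, -p, g, by simpa using hpq.symm, ?_, rfl⟩
  refine isHomogeneous_of_mul ?_ (isHomogeneous_linForm q (-p)) (by rwa [add_comm])
  rw [Ne, linForm_eq_zero_iff, neg_eq_zero]
  tauto

lemma dirDeriv_linForm_self (a b : ℂ) : dirDeriv a b (linForm b (-a)) = 0 := by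
  rw [dirDeriv_linForm, mul_neg, mul_comm b, add_neg_cancel, C_0]

lemma linForm_ne_zero {a b : ℂ} (hab : a ≠ 0 ∨ b ≠ 0) : linForm a b ≠ 0 := by
  rw [Ne, linForm_eq_zero_iff]
  tauto

lemma linForm_neg_ne_zero {a b : ℂ} (hab : a ≠ 0 ∨ b ≠ 0) : linForm b (-a) ≠ 0 :=
  linForm_ne_zero (by simpa using hab.symm)

lemma dirDeriv_pow_eq_zero {a b : ℂ} {L : MvPolynomial (Fin 2) ℂ} (hL : dirDeriv a b L = 0)
    (k : ℕ) : dirDeriv a b (L ^ k) = 0 := by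
  rw [Derivation.leibniz_pow, hL, smul_zero, smul_zero]

lemma dirDeriv_mul_pow {a b : ℂ} {L : MvPolynomial (Fin 2) ℂ} (hL : dirDeriv a b L = 0)
    (G : MvPolynomial (Fin 2) ℂ) (k : ℕ) :
    dirDeriv a b (G * L ^ k) = dirDeriv a b G * L ^ k := by
  rw [Derivation.leibniz, dirDeriv_pow_eq_zero hL, smul_zero, zero_add, smul_eq_mul, mul_comm]

lemma pderiv_dirDeriv (i : Fin 2) (a b : ℂ) (f : MvPolynomial (Fin 2) ℂ) :
    pderiv i (dirDeriv a b f) = dirDeriv a b (pderiv i f) := by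
  simp [dirDeriv, pderiv_commute i]

lemma isHomogeneous_contractOp {k : ℕ} : ∀ {n : ℕ} {φ f : MvPolynomial (Fin 2) ℂ},
    φ.IsHomogeneous k → f.IsHomogeneous n → (contractOp φ f).IsHomogeneous (n - k) := by
  induction k with
  | zero =>
    intro n φ f hφ hf
    rw [eq_C_of_isHomogeneous_zero hφ, contractOp_C]
    exact isHomogeneous_smul hf _
  | succ k ih =>
    intro n φ f hφ hf
    obtain ⟨a, b, ψ, -, hψ, rfl⟩ := exists_eq_linForm_mul hφ
    rw [contractOp_mul, contractOp_linForm, ← Nat.sub_sub]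
    exact isHomogeneous_dirDeriv (ih hψ hf) a b

lemma eq_smul_pow_of_dirDeriv_eq_zero {a b : ℂ} (hab : a ≠ 0 ∨ b ≠ 0) {n : ℕ} :
    ∀ {f : MvPolynomial (Fin 2) ℂ}, f.IsHomogeneous n → dirDeriv a b f = 0 →
      ∃ c : ℂ, f = c • linForm b (-a) ^ n := by
  induction n with
  | zero =>
    intro f hf _
    exact ⟨coeff 0 f, by
      rw [pow_zero, smul_eq_C_mul, mul_one]; exact eq_C_of_isHomogeneous_zero hf⟩
  | succ n ih =>
    intro f hf h
    obtain ⟨c₀, h₀⟩ := ih (hf.pderiv (i := 0)) (by rw [← pderiv_dirDeriv, h, map_zero])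
    obtain ⟨c₁, h₁⟩ := ih (hf.pderiv (i := 1)) (by rw [← pderiv_dirDeriv, h, map_zero])
    have hrel : a * c₀ + b * c₁ = 0 := by
      have h' : dirDeriv a b f = (a * c₀ + b * c₁) • linForm b (-a) ^ n := by
        simp only [dirDeriv, Derivation.add_apply, Derivation.smul_apply, h₀, h₁, smul_smul,
          add_smul]
      rw [h, eq_comm, smul_eq_zero] at h'
      exact h'.resolve_right (pow_ne_zero _ (linForm_neg_ne_zero hab))
    obtain ⟨t, ht⟩ := exists_linForm_eq_smul hab hrel
    have heuler := hf.sum_X_mul_pderiv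
    rw [Fin.sum_univ_two, h₀, h₁] at heuler
    have hmul : ((n + 1 : ℕ) : ℂ) • f = t • linForm b (-a) ^ (n + 1) := by
      rw [Nat.cast_smul_eq_nsmul, ← heuler, pow_succ', ← smul_mul_assoc, ← ht]
      simp only [linForm, smul_eq_C_mul]
      ring
    have hn : ((n + 1 : ℕ) : ℂ) ≠ 0 := by exact_mod_cast n.succ_ne_zero
    exact ⟨((n + 1 : ℕ) : ℂ)⁻¹ * t, by rw [mul_smul, ← hmul, inv_smul_smul₀ hn]⟩

/-- Integration of `G * L ^ N` along a direction in which `L` is not constant. -/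
lemma exists_dirDeriv_mul_pow_eq {a b c : ℂ} {L : MvPolynomial (Fin 2) ℂ}
    (hLhom : L.IsHomogeneous 1) (hc : c ≠ 0) (hL : dirDeriv a b L = C c) {m : ℕ} :
    ∀ {G : MvPolynomial (Fin 2) ℂ} (N : ℕ), G.IsHomogeneous m →
      ∃ H : MvPolynomial (Fin 2) ℂ, H.IsHomogeneous m ∧
        dirDeriv a b (H * L ^ (N + 1)) = G * L ^ N := by
  have hpow (N : ℕ) : dirDeriv a b (L ^ (N + 1)) = C ((N + 1 : ℕ) * c) * L ^ N := by
    rw [Derivation.leibniz_pow, hL, nsmul_eq_mul, smul_eq_mul, Nat.add_sub_cancel, C_mul,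
      map_natCast]
    ring
  have key (N : ℕ) {G H' : MvPolynomial (Fin 2) ℂ}
      (h : dirDeriv a b (H' * L ^ (N + 2)) = dirDeriv a b G * L ^ (N + 1)) :
      dirDeriv a b ((C (((N + 1 : ℕ) : ℂ) * c)⁻¹ * (G - H' * L)) * L ^ (N + 1)) = G * L ^ N := by
    have hN : ((N + 1 : ℕ) : ℂ) * c ≠ 0 := mul_ne_zero (by exact_mod_cast N.succ_ne_zero) hc
    have e : (C (((N + 1 : ℕ) : ℂ) * c)⁻¹ * (G - H' * L)) * L ^ (N + 1) =
        (((N + 1 : ℕ) : ℂ) * c)⁻¹ • (G * L ^ (N + 1) - H' * L ^ (N + 2)) := by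
      rw [smul_eq_C_mul]; ring
    rw [e, Derivation.map_smul, map_sub, h, Derivation.leibniz, hpow, inv_smul_eq_iff₀ hN]
    simp only [smul_eq_mul, smul_eq_C_mul]
    ring
  induction m with
  | zero =>
    intro G N hG
    refine ⟨_, (hG.sub ?_).C_mul _, key N (H' := 0) ?_⟩
    · rw [zero_mul]; exact isHomogeneous_zero _ _ _
    · rw [zero_mul, map_zero, dirDeriv_eq_zero_of_degree_zero hG, zero_mul]
  | succ m ih =>
    intro G N hG
    obtain ⟨H', hH', h⟩ := ih (N + 1) (isHomogeneous_dirDeriv hG a b)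
    exact ⟨_, (hG.sub (hH'.mul hLhom)).C_mul _, key N h⟩

lemma exists_dirDeriv_eq {a b : ℂ} (hab : a ≠ 0 ∨ b ≠ 0) {m : ℕ} {G : MvPolynomial (Fin 2) ℂ}
    (hG : G.IsHomogeneous m) :
    ∃ H : MvPolynomial (Fin 2) ℂ, H.IsHomogeneous (m + 1) ∧ dirDeriv a b H = G := by
  obtain ⟨p, q, hpq⟩ : ∃ p q, a * p + b * q ≠ 0 := by
    rcases hab with h | h
    · exact ⟨1, 0, by simpa using h⟩
    · exact ⟨0, 1, by simpa using h⟩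
  obtain ⟨H, hH, h⟩ := exists_dirDeriv_mul_pow_eq (isHomogeneous_linForm p q) hpq
    (dirDeriv_linForm a b p q) 0 hG
  exact ⟨H * linForm p q, hH.mul (isHomogeneous_linForm p q), by simpa using h⟩

lemma IsLinearForm.eq_smul_of_dirDeriv_eq_zero {a b : ℂ} (hab : a ≠ 0 ∨ b ≠ 0)
    {L : MvPolynomial (Fin 2) ℂ} (hL : IsLinearForm L) (h : dirDeriv a b L = 0) :
    ∃ t : ℂ, t ≠ 0 ∧ L = t • linForm b (-a) := by
  obtain ⟨t, ht⟩ := eq_smul_pow_of_dirDeriv_eq_zero hab hL.2 h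
  rw [pow_one] at ht
  exact ⟨t, fun h0 => hL.1 (by rw [ht, h0, zero_smul]), ht⟩

lemma IsLinearForm.exists_dirDeriv_eq_C {L : MvPolynomial (Fin 2) ℂ} (hL : IsLinearForm L)
    (a b : ℂ) : ∃ c, dirDeriv a b L = C c := by
  obtain ⟨p, q, rfl⟩ := exists_eq_linForm hL.2
  exact ⟨_, dirDeriv_linForm a b p q⟩

/-- A form of degree `n` annihilated by a nonzero form of degree `d ≤ n` has a generalized
additive decomposition of length at most `d`. -/
lemma exists_isGAD_of_contractOp_eq_zero {d : ℕ} : ∀ {n : ℕ} {δ f : MvPolynomial (Fin 2) ℂ},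
    δ ≠ 0 → δ.IsHomogeneous d → f.IsHomogeneous n → d ≤ n → contractOp δ f = 0 →
      ∃ m L g G, IsGAD n f m L g G ∧ ∑ i, g i ≤ d := by
  classical
  induction d with
  | zero =>
    intro n δ f hδ0 hδ hf _ h
    rw [eq_C_of_isHomogeneous_zero hδ] at h hδ0
    rw [contractOp_C, smul_eq_zero] at h
    have hf0 := h.resolve_left fun h0 => hδ0 (by rw [h0, C_0])
    exact ⟨0, Fin.elim0, Fin.elim0, Fin.elim0, ⟨fun i => i.elim0, fun i => i.elim0,
      fun i => i.elim0, fun i => i.elim0, by simpa using hf0⟩, by simp⟩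
  | succ d ih =>
    intro n δ f hδ0 hδ hf hdn h
    obtain ⟨a, b, δ', hab, hδ', rfl⟩ := exists_eq_linForm_mul hδ
    rw [mul_comm, contractOp_mul, contractOp_linForm] at h
    obtain ⟨m, L, g, G, ⟨hL, hprop, hg, hG, hsum⟩, hle⟩ :=
      ih (right_ne_zero_of_mul hδ0) hδ' (isHomogeneous_dirDeriv hf a b) (by omega) h
    have hgd (i : Fin m) : g i ≤ d :=
      (Finset.single_le_sum (fun _ _ => Nat.zero_le _) (Finset.mem_univ i)).trans hle
    let g' : Fin m → ℕ := fun i => if dirDeriv a b (L i) = 0 then g i + 1 else g i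
    have hg'_pos (i : Fin m) : 1 ≤ g' i := by
      have := hg i
      simp only [g']; split_ifs <;> omega
    have hg'_le (i : Fin m) : g' i ≤ n := by
      have := hgd i
      simp only [g']; split_ifs <;> omega
    have hex (i : Fin m) : ∃ H : MvPolynomial (Fin 2) ℂ, H.IsHomogeneous (g' i - 1) ∧
        dirDeriv a b (H * L i ^ (n - g' i + 1)) = G i * L i ^ (n - 1 - g i + 1) := by
      have h1 := hg i
      have h2 := hgd i
      by_cases hi : dirDeriv a b (L i) = 0
      · obtain ⟨H, hH, hDH⟩ := exists_dirDeriv_eq hab (hG i)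
        refine ⟨H, ?_, ?_⟩
        · simpa only [g', if_pos hi, Nat.sub_add_cancel h1, Nat.add_sub_cancel] using hH
        · rw [dirDeriv_mul_pow hi, hDH]
          simp only [g', if_pos hi]
          congr 2
          omega
      · obtain ⟨c, hc⟩ := (hL i).exists_dirDeriv_eq_C a b
        have hc0 : c ≠ 0 := fun h0 => hi (by rw [hc, h0, C_0])
        obtain ⟨H, hH, hDH⟩ := exists_dirDeriv_mul_pow_eq (hL i).2 hc0 hc (n - g i) (hG i)
        refine ⟨H, ?_, ?_⟩
        · simpa only [g', if_neg hi] using hH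
        · simp only [g', if_neg hi]
          rw [hDH]
          congr 2
          omega
    choose H hH hDH using hex
    have hterm (i : Fin m) : (H i * L i ^ (n - g' i + 1)).IsHomogeneous n := by
      have h1 := hg'_pos i
      have h2 := hg'_le i
      convert (hH i).mul ((hL i).2.pow (n - g' i + 1)) using 1
      omega
    obtain ⟨c, hc⟩ := eq_smul_pow_of_dirDeriv_eq_zero hab
      (hf.sub (IsHomogeneous.sum Finset.univ _ n fun i _ => hterm i))
      (by rw [map_sub, map_sum, Finset.sum_congr rfl fun i _ => hDH i, hsum, sub_self])
    rw [sub_eq_iff_eq_add'] at hc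
    by_cases hex0 : ∃ i₀, dirDeriv a b (L i₀) = 0
    · obtain ⟨i₀, hi₀⟩ := hex0
      obtain ⟨t, ht0, ht⟩ := (hL i₀).eq_smul_of_dirDeriv_eq_zero hab hi₀
      have huniq (i : Fin m) (hi : dirDeriv a b (L i) = 0) : i = i₀ := by
        by_contra hne
        obtain ⟨u, -, hu⟩ := (hL i).eq_smul_of_dirDeriv_eq_zero hab hi
        exact hprop i₀ i (Ne.symm hne) ⟨u * t⁻¹, by
          rw [ht, smul_smul, inv_mul_cancel_right₀ ht0, hu]⟩
      refine ⟨m, L, g', fun i => H i +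
        if i = i₀ then (c * t⁻¹ ^ n) • L i ^ (g' i - 1) else 0, ⟨hL, hprop, hg'_pos, ?_, ?_⟩, ?_⟩
      · intro i
        refine (hH i).add ?_
        split_ifs
        · simpa using isHomogeneous_smul ((hL i).2.pow (g' i - 1)) (c * t⁻¹ ^ n)
        · exact isHomogeneous_zero _ _ _
      · rw [hc]
        simp only [add_mul, Finset.sum_add_distrib, ite_mul, zero_mul, Finset.sum_ite_eq',
          Finset.mem_univ, if_true]
        rw [smul_mul_assoc, ← pow_add]
        have h1 := hg'_pos i₀
        have h2 := hg'_le i₀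
        rw [show g' i₀ - 1 + (n - g' i₀ + 1) = n by omega, ht, smul_pow, smul_smul, mul_assoc,
          ← mul_pow, inv_mul_cancel₀ ht0, one_pow, mul_one]
      · have hle' : ∑ i, g' i ≤ ∑ i, (g i + if i = i₀ then 1 else 0) := by
          refine Finset.sum_le_sum fun i _ => ?_
          simp only [g']
          split_ifs with h1 h2 h2
          · exact le_rfl
          · exact absurd (huniq i h1) h2
          · omega
          · exact le_rfl
        rw [Finset.sum_add_distrib, Finset.sum_ite_eq' Finset.univ i₀,
          if_pos (Finset.mem_univ i₀)] at hle'
        omega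
    · push Not at hex0
      have hg' : g' = g := funext fun i => if_neg (hex0 i)
      rw [hg'] at hc hH
      have hM : IsLinearForm (linForm b (-a)) :=
        ⟨linForm_neg_ne_zero hab, isHomogeneous_linForm _ _⟩
      refine ⟨m + 1, Fin.cons (linForm b (-a)) L, Fin.cons 1 g, Fin.cons (C c) H,
        ⟨?_, ?_, ?_, ?_, ?_⟩, ?_⟩
      · exact Fin.cases hM hL
      · refine Fin.cases (Fin.cases (by simp) fun j _ => ?_)
          fun i => Fin.cases (fun _ => ?_) fun j hij => ?_
        · rintro ⟨u, hu⟩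
          simp only [Fin.cons_succ, Fin.cons_zero] at hu
          exact hex0 j (by rw [hu, Derivation.map_smul, dirDeriv_linForm_self, smul_zero])
        · rintro ⟨u, hu⟩
          simp only [Fin.cons_succ, Fin.cons_zero] at hu
          have hD := dirDeriv_linForm_self a b
          rw [hu, Derivation.map_smul, smul_eq_zero] at hD
          exact hM.1 (by rw [hu, hD.resolve_right (hex0 i), zero_smul])
        · simpa using hprop i j fun h => hij (congrArg Fin.succ h)
      · exact Fin.cases le_rfl hg
      · exact Fin.cases (isHomogeneous_C _ c) hH
      · rw [Fin.sum_univ_succ]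
        simp only [Fin.cons_zero, Fin.cons_succ]
        rw [Nat.sub_add_cancel (by omega : 1 ≤ n), ← smul_eq_C_mul, add_comm]
        exact hc
      · rw [Fin.sum_univ_succ]
        simp only [Fin.cons_zero, Fin.cons_succ]
        omega

lemma contractOp_linForm_pow_mul_pow (p q : ℂ) {k : ℕ} :
    ∀ {G : MvPolynomial (Fin 2) ℂ} (N : ℕ), G.IsHomogeneous k →
      contractOp (linForm (-q) p ^ (k + 1)) (G * linForm p q ^ N) = 0 := by
  have hD : dirDeriv (-q) p (linForm p q) = 0 := by simpa using dirDeriv_linForm_self (-q) p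
  induction k with
  | zero =>
    intro G N hG
    rw [zero_add, pow_one, contractOp_linForm, dirDeriv_mul_pow hD,
      dirDeriv_eq_zero_of_degree_zero hG, zero_mul]
  | succ k ih =>
    intro G N hG
    rw [pow_succ, contractOp_mul, contractOp_linForm, dirDeriv_mul_pow hD]
    exact ih N (isHomogeneous_dirDeriv hG _ _)

lemma HasGADLength.exists_contractOp_eq_zero {n s : ℕ} {f : MvPolynomial (Fin 2) ℂ}
    (h : HasGADLength n f s) :
    ∃ α : MvPolynomial (Fin 2) ℂ, α ≠ 0 ∧ α.IsHomogeneous s ∧ contractOp α f = 0 := by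
  classical
  obtain ⟨m, L, g, G, ⟨hL, -, hg, hG, rfl⟩, rfl⟩ := h
  choose p q hpq using fun i => exists_eq_linForm (hL i).2
  refine ⟨∏ i, linForm (-q i) (p i) ^ g i, ?_, ?_, ?_⟩
  · refine Finset.prod_ne_zero_iff.2 fun i _ => pow_ne_zero _ (linForm_ne_zero ?_)
    have := (hL i).1
    rw [hpq, Ne, linForm_eq_zero_iff] at this
    rw [neg_ne_zero]
    tauto
  · refine IsHomogeneous.prod _ _ _ fun i _ => ?_
    simpa using (isHomogeneous_linForm (-q i) (p i)).pow (g i)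
  · rw [contractOp_sum_right]
    refine Finset.sum_eq_zero fun i _ => ?_
    rw [← Finset.prod_erase_mul _ _ (Finset.mem_univ i), contractOp_mul, hpq i]
    have h0 := contractOp_linForm_pow_mul_pow (p i) (q i) (n - g i + 1) (hG i)
    rw [Nat.sub_add_cancel (hg i)] at h0
    rw [h0, contractOp_zero_right]

lemma exists_eq_linForm_mul_of_contractOp_pow {a b : ℂ} (hab : a ≠ 0 ∨ b ≠ 0) {k : ℕ} :
    ∀ {K : ℕ} {c : ℂ} {β : MvPolynomial (Fin 2) ℂ}, β.IsHomogeneous k → β ≠ 0 → c ≠ 0 → k ≤ K →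
      contractOp β (c • linForm b (-a) ^ K) = 0 →
        ∃ k' γ, k = k' + 1 ∧ γ.IsHomogeneous k' ∧ β = linForm a b * γ := by
  induction k with
  | zero =>
    intro K c β hβ hβ0 hc _ h
    rw [eq_C_of_isHomogeneous_zero hβ] at h hβ0
    rw [contractOp_C, smul_eq_zero, smul_eq_zero] at h
    rcases h with h | h | h
    · exact absurd (by rw [h, C_0]) hβ0
    · exact absurd h hc
    · exact absurd h (pow_ne_zero _ (linForm_neg_ne_zero hab))
  | succ k ih =>
    intro K c β hβ hβ0 hc hkK h
    obtain ⟨p, q, γ, hpq, hγ, rfl⟩ := exists_eq_linForm_mul hβ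
    by_cases he : p * b + q * -a = 0
    · obtain ⟨t, ht⟩ := exists_linForm_eq_smul (a := b) (b := -a) (p := p) (q := q)
        (by simpa using hab.symm) (by linear_combination he)
      refine ⟨k, -t • γ, rfl, isHomogeneous_smul hγ _, ?_⟩
      rw [ht]
      simp only [linForm, smul_eq_C_mul, C_neg]
      ring
    · obtain ⟨K, rfl⟩ : ∃ K', K = K' + 1 := ⟨K - 1, by omega⟩
      have hD : dirDeriv p q (c • linForm b (-a) ^ (K + 1)) =
          (c * ((K + 1 : ℕ) * (p * b + q * -a))) • linForm b (-a) ^ K := by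
        rw [Derivation.map_smul, Derivation.leibniz_pow, dirDeriv_linForm, Nat.add_sub_cancel,
          mul_smul, mul_smul, Nat.cast_smul_eq_nsmul, smul_eq_mul, smul_eq_C_mul _ (_ + _),
          mul_comm (C _)]
      rw [mul_comm, contractOp_mul, contractOp_linForm, hD] at h
      have hK : ((K + 1 : ℕ) : ℂ) ≠ 0 := by exact_mod_cast K.succ_ne_zero
      obtain ⟨k', γ', rfl, hγ', rfl⟩ := ih hγ (right_ne_zero_of_mul hβ0)
        (mul_ne_zero hc (mul_ne_zero hK he)) (by omega) h
      exact ⟨k' + 1, linForm p q * γ', rfl, by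
        rw [add_comm]; exact (isHomogeneous_linForm p q).mul hγ', by ring⟩

/-- If forms of degrees `p` and `q` with `p + q ≤ N + 1` annihilate a form of degree `N`, then
so does some common divisor of them. -/
lemma exists_common_factor_contractOp_eq_zero {p : ℕ} :
    ∀ {q N : ℕ} {A B g : MvPolynomial (Fin 2) ℂ}, A.IsHomogeneous p → A ≠ 0 →
      B.IsHomogeneous q → B ≠ 0 → g.IsHomogeneous N → p + q ≤ N + 1 →
      contractOp A g = 0 → contractOp B g = 0 →
      ∃ e j k δ A' B', δ.IsHomogeneous e ∧ A'.IsHomogeneous j ∧ B'.IsHomogeneous k ∧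
        e + j = p ∧ e + k = q ∧ A = δ * A' ∧ B = δ * B' ∧ contractOp δ g = 0 := by
  induction p with
  | zero =>
    intro q N A B g hA hA0 hB _ _ _ hAg _
    refine ⟨0, 0, q, 1, A, B, isHomogeneous_one _ _, hA, hB, rfl, zero_add q,
      (one_mul A).symm, (one_mul B).symm, ?_⟩
    rw [eq_C_of_isHomogeneous_zero hA] at hAg hA0
    rw [contractOp_C, smul_eq_zero] at hAg
    rw [hAg.resolve_left fun h0 => hA0 (by rw [h0, C_0]), contractOp_zero_right]
  | succ p ih =>
    intro q N A B g hA hA0 hB hB0 hg hpq hAg hBg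
    obtain ⟨a, b, A₁, hab, hA₁, rfl⟩ := exists_eq_linForm_mul hA
    obtain ⟨e, j, k, δ, A', B', hδ, hA', hB', rfl, rfl, rfl, rfl, hδg⟩ :=
      ih hA₁ (right_ne_zero_of_mul hA0) hB hB0 (isHomogeneous_dirDeriv hg a b) (by omega)
        (by rw [← contractOp_linForm, ← contractOp_mul, mul_comm, hAg])
        (by rw [← contractOp_linForm, ← contractOp_mul, mul_comm, contractOp_mul, hBg,
          contractOp_zero_right])
    rw [← contractOp_linForm, ← contractOp_mul, mul_comm, contractOp_mul,
      contractOp_linForm] at hδg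
    obtain ⟨c, hc⟩ := eq_smul_pow_of_dirDeriv_eq_zero hab (isHomogeneous_contractOp hδ hg) hδg
    by_cases hc0 : c = 0
    · refine ⟨e, 1 + j, k, δ, linForm a b * A', B', hδ, (isHomogeneous_linForm a b).mul hA', hB',
        by omega, rfl, by ring, rfl, by rw [hc, hc0, zero_smul]⟩
    · rw [mul_comm δ B', contractOp_mul, hc] at hBg
      obtain ⟨k', γ, rfl, hγ, rfl⟩ := exists_eq_linForm_mul_of_contractOp_pow hab hB'
        (right_ne_zero_of_mul hB0) hc0 (by omega) hBg
      refine ⟨1 + e, j, k', linForm a b * δ, A', γ, (isHomogeneous_linForm a b).mul hδ, hA', hγ,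
        by omega, by omega, by ring, by ring, ?_⟩
      rw [contractOp_mul, contractOp_linForm, hδg]

theorem apolar_principal_part (n s : ℕ)
    (f : MvPolynomial (Fin 2) ℂ) (hf0 : f ≠ 0) (hf : f.IsHomogeneous n)
    (hlen : IsLeast {l | HasGADLength n f l} s) (h2s : 2 * s ≤ n + 1) :
    Module.finrank ℂ
      ↥(Submodule.span ℂ {φ : MvPolynomial (Fin 2) ℂ |
        φ.IsHomogeneous s ∧ contractOp φ f = 0}) = 1 ∧
    ∃ α : MvPolynomial (Fin 2) ℂ, α ≠ 0 ∧ α.IsHomogeneous s ∧ contractOp α f = 0 ∧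
      ∀ v : ℕ, s ≤ v → v ≤ n + 1 - s →
        ∀ φ : MvPolynomial (Fin 2) ℂ,
          (φ.IsHomogeneous v ∧ contractOp φ f = 0) ↔
          ∃ ψ : MvPolynomial (Fin 2) ℂ, ψ.IsHomogeneous (v - s) ∧ φ = ψ * α := by
  obtain ⟨α, hα0, hα, hαf⟩ := hlen.1.exists_contractOp_eq_zero
  have hmin {e : ℕ} {δ : MvPolynomial (Fin 2) ℂ} (hδ0 : δ ≠ 0) (hδ : δ.IsHomogeneous e)
      (hδf : contractOp δ f = 0) : s ≤ e := by
    by_contra! hlt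
    obtain ⟨m, L, g, G, hGAD, hle⟩ :=
      exists_isGAD_of_contractOp_eq_zero hδ0 hδ hf (by omega) hδf
    have := hlen.2 ⟨m, L, g, G, hGAD, rfl⟩
    omega
  have key (v : ℕ) (hsv : s ≤ v) (hvn : v ≤ n + 1 - s) (φ : MvPolynomial (Fin 2) ℂ) :
      (φ.IsHomogeneous v ∧ contractOp φ f = 0) ↔
        ∃ ψ : MvPolynomial (Fin 2) ℂ, ψ.IsHomogeneous (v - s) ∧ φ = ψ * α := by
    constructor
    · rintro ⟨hφ, hφf⟩
      by_cases hφ0 : φ = 0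
      · exact ⟨0, isHomogeneous_zero _ _ _, by rw [hφ0, zero_mul]⟩
      obtain ⟨e, j, k, δ, A', B', hδ, hA', hB', hej, rfl, rfl, rfl, hδf⟩ :=
        exists_common_factor_contractOp_eq_zero hα hα0 hφ hφ0 hf (by omega) hαf hφf
      have hse := hmin (left_ne_zero_of_mul hα0) hδ hδf
      obtain rfl : j = 0 := by omega
      obtain rfl : e = s := by omega
      have hA := eq_C_of_isHomogeneous_zero hA'
      have hc : coeff 0 A' ≠ 0 := fun h0 => hα0 (by rw [hA, h0, C_0, mul_zero])
      refine ⟨C (coeff 0 A')⁻¹ * B', ?_, ?_⟩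
      · rw [Nat.add_sub_cancel_left]
        exact hB'.C_mul _
      · have hinv : C (coeff 0 A')⁻¹ * A' = 1 := by
          nth_rw 2 [hA]
          rw [← C_mul, inv_mul_cancel₀ hc, C_1]
        linear_combination (-δ * B') * hinv
    · rintro ⟨ψ, hψ, rfl⟩
      refine ⟨?_, by rw [contractOp_mul, hαf, contractOp_zero_right]⟩
      have := hψ.mul hα
      rwa [Nat.sub_add_cancel hsv] at this
  refine ⟨?_, α, hα0, hα, hαf, key⟩
  have hspan : Submodule.span ℂ {φ : MvPolynomial (Fin 2) ℂ |
      φ.IsHomogeneous s ∧ contractOp φ f = 0} = Submodule.span ℂ {α} := by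
    refine le_antisymm (Submodule.span_le.2 fun φ hφ => ?_)
      (Submodule.span_mono (Set.singleton_subset_iff.2 ⟨hα, hαf⟩))
    obtain ⟨ψ, hψ, rfl⟩ := (key s le_rfl (by omega) φ).1 hφ
    rw [Nat.sub_self] at hψ
    rw [eq_C_of_isHomogeneous_zero hψ, ← smul_eq_C_mul]
    exact Submodule.smul_mem _ _ (Submodule.mem_span_singleton_self α)
  rw [hspan, finrank_span_singleton hα0]
end

section
/- Let f be a nonzero binary form of degree n with length s = l(f). Then the apolar ideal Ann(f) ⊂ ℂ[∂_0, ∂_1] is a complete intersection generated by two homogeneous polynomials α of degree s and β of degree n + 2 - s, and α and β have no common zeros. -/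
open MvPolynomial

theorem homogeneousComponent_mul_of_left {σ R : Type*} [CommSemiring R] {i : ℕ}
    {a : MvPolynomial σ R} (ha : a.IsHomogeneous i) (b : MvPolynomial σ R) (n : ℕ) :
    homogeneousComponent n (a * b) =
      if i ≤ n then a * homogeneousComponent (n - i) b else 0 := by
  have h : ∀ j, homogeneousComponent n (a * homogeneousComponent j b) =
      if n = i + j then a * homogeneousComponent j b else 0 := fun j =>
    homogeneousComponent_of_mem (ha.mul (homogeneousComponent_isHomogeneous j b))
  conv_lhs => rw [← sum_homogeneousComponent b, Finset.mul_sum, map_sum]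
  simp_rw [h]
  split_ifs with hin
  · have h' : ∀ j, n = i + j ↔ n - i = j := fun j => by omega
    simp_rw [h', Finset.sum_ite_eq]
    split_ifs with hj
    · rfl
    · rw [homogeneousComponent_eq_zero _ _ 
        (by simp only [Finset.mem_range, not_lt] at hj; omega), mul_zero]
  · exact Finset.sum_eq_zero fun j _ => if_neg (by omega)

/-- A homogeneous multiple of a nonzero homogeneous polynomial has a homogeneous cofactor. -/
theorem isHomogeneous_of_mul_left {σ R : Type*} [CommRing R] [IsDomain R] {i k : ℕ}
    {a b : MvPolynomial σ R} (ha : a.IsHomogeneous i) (ha0 : a ≠ 0)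
    (hab : (a * b).IsHomogeneous (i + k)) : b.IsHomogeneous k := by
  have h := homogeneousComponent_mul_of_left ha b (i + k)
  rw [homogeneousComponent_eq_self hab, if_pos (Nat.le_add_right i k),
    Nat.add_sub_cancel_left] at h
  rw [mul_left_cancel₀ ha0 h]
  exact homogeneousComponent_isHomogeneous k b

/-- A nonzero homogeneous multiple has degree at least that of its homogeneous factor. -/
theorem le_of_isHomogeneous_mul {σ R : Type*} [CommSemiring R] {i n : ℕ}
    {a b : MvPolynomial σ R} (ha : a.IsHomogeneous i) (hab : (a * b).IsHomogeneous n)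
    (h0 : a * b ≠ 0) : i ≤ n := by
  by_contra h
  apply h0
  rw [← homogeneousComponent_eq_self hab,
    homogeneousComponent_mul_of_left ha b, if_neg h]

theorem aeval_mul_of_isHomogeneous {σ R A : Type*} [CommSemiring R] [CommSemiring A] [Algebra R A]
    {k : ℕ} {φ : MvPolynomial σ R} (hφ : φ.IsHomogeneous k) (c : A) (x : σ → A) :
    aeval (fun i => c * x i) φ = c ^ k * aeval x φ := by
  rw [aeval_def, aeval_def, eval₂_eq, eval₂_eq, Finset.mul_sum]
  refine Finset.sum_congr rfl fun d hd => ?_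
  have h : ∑ i ∈ d.support, d i = k := by
    rw [← Finsupp.degree_apply]; 
    by_contra h
    exact (mem_support_iff.1 hd) (hφ.coeff_eq_zero h)
  rw [← h, ← Finset.prod_pow_eq_pow_sum]
  simp only [mul_pow, Finset.prod_mul_distrib]
  ring

/-- The linear form vanishing at the point `p`. -/
noncomputable def vanishingForm (p : Fin 2 → ℂ) : MvPolynomial (Fin 2) ℂ :=
  C (p 1) * X 0 - C (p 0) * X 1

theorem vanishingForm_isHomogeneous (p : Fin 2 → ℂ) : (vanishingForm p).IsHomogeneous 1 :=
  (isHomogeneous_C_mul_X _ _).sub (isHomogeneous_C_mul_X _ _)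

@[simp]
theorem eval_vanishingForm (p q : Fin 2 → ℂ) :
    eval q (vanishingForm p) = p 1 * q 0 - p 0 * q 1 := by
  simp [vanishingForm]

theorem vanishingForm_ne_zero {p : Fin 2 → ℂ} (hp : p ≠ 0) : vanishingForm p ≠ 0 := by
  intro h
  apply hp
  have h0 := eval_vanishingForm p ![1, 0]
  have h1 := eval_vanishingForm p ![0, 1]
  rw [h] at h0 h1
  ext i
  fin_cases i
  · simpa using h1.symm
  · simpa using h0.symm

theorem vanishingForm_dvd {k : ℕ} {φ : MvPolynomial (Fin 2) ℂ} (hφ : φ.IsHomogeneous k)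
    {p : Fin 2 → ℂ} (hp : p ≠ 0) (h : eval p φ = 0) : vanishingForm p ∣ φ := by
  obtain ⟨i, hi⟩ : ∃ i, p i ≠ 0 := Function.ne_iff.1 hp
  set I : Ideal (MvPolynomial (Fin 2) ℂ) := Ideal.span {vanishingForm p}
  have hrel : ∀ j, Ideal.Quotient.mk I (C (p i) * X j) = Ideal.Quotient.mk I (X i * C (p j)) := by
    intro j
    rw [Ideal.Quotient.eq, Ideal.mem_span_singleton]
    fin_cases i <;> fin_cases j <;> simp only [vanishingForm, Fin.zero_eta, Fin.mk_one]
    · exact ⟨0, by ring⟩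
    · exact ⟨-1, by ring⟩
    · exact ⟨1, by ring⟩
    · exact ⟨0, by ring⟩
  have h1 := aeval_mul_of_isHomogeneous hφ (C (p i) : MvPolynomial (Fin 2) ℂ) X
  have h2 := aeval_mul_of_isHomogeneous hφ (X i : MvPolynomial (Fin 2) ℂ) (fun j => C (p j))
  have h3 : aeval (fun j => (C (p j) : MvPolynomial (Fin 2) ℂ)) φ = C (eval p φ) := by
    rw [← algebraMap_eq, ← coe_aeval_eq_eval]
    exact aeval_algebraMap_apply (MvPolynomial (Fin 2) ℂ) p φ
  have h4 : Ideal.Quotient.mkₐ ℂ I (aeval (fun j => C (p i) * X j) φ) =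
      Ideal.Quotient.mkₐ ℂ I (aeval (fun j => X i * C (p j)) φ) := by
    rw [comp_aeval_apply, comp_aeval_apply]
    congr 2
    funext j
    exact hrel j
  rw [h1, h2, h3, h, C_0, mul_zero, map_zero, aeval_X_left_apply] at h4
  have h5 : C (p i) ^ k * φ ∈ I := Ideal.Quotient.eq_zero_iff_mem.1 h4
  rw [Ideal.mem_span_singleton, ← C_pow] at h5
  have hu : IsUnit (C (p i ^ k) : MvPolynomial (Fin 2) ℂ) := (pow_ne_zero k hi).isUnit.map C
  exact hu.dvd_mul_left.1 h5

theorem exists_eq_vanishingForm_mul {k : ℕ} {φ : MvPolynomial (Fin 2) ℂ}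
    (hφ : φ.IsHomogeneous (k + 1)) {p : Fin 2 → ℂ} (hp : p ≠ 0) (h : eval p φ = 0) :
    ∃ ψ, ψ.IsHomogeneous k ∧ φ = vanishingForm p * ψ := by
  obtain ⟨ψ, rfl⟩ := vanishingForm_dvd hφ hp h
  refine ⟨ψ, ?_, rfl⟩
  rw [add_comm] at hφ
  exact isHomogeneous_of_mul_left (vanishingForm_isHomogeneous p) (vanishingForm_ne_zero hp) hφ

theorem exists_eval_eq_zero_s11 {k : ℕ} {φ : MvPolynomial (Fin 2) ℂ}
    (hφ : φ.IsHomogeneous (k + 1)) :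
    ∃ p : Fin 2 → ℂ, (p = ![1, 0] ∨ ∃ a, p = ![a, 1]) ∧ eval p φ = 0 := by
  set P : Polynomial ℂ := aeval ![Polynomial.X, 1] φ with hP
  have hφP : φ = P.homogenize (k + 1) :=
    (Polynomial.homogenize_eq_of_isHomogeneous hφ hP.symm).symm
  by_cases hd : P.degree = 0
  · refine ⟨![1, 0], Or.inl rfl, ?_⟩
    rw [hφP, Polynomial.eq_C_of_degree_eq_zero hd]
    simp
  · obtain ⟨a, ha⟩ := IsAlgClosed.exists_root P hd
    refine ⟨![a, 1], Or.inr ⟨a, rfl⟩, ?_⟩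
    have h : Polynomial.aeval a P = aeval ![a, 1] φ := by
      rw [hP, comp_aeval_apply]
      congr 2
      funext j
      fin_cases j <;> simp
    rw [← coe_aeval_eq_eval]
    change aeval ![a, 1] φ = 0
    rw [← h, Polynomial.coe_aeval_eq_eval]
    exact ha

theorem finrank_homogeneousSubmodule_fin_two (k : ℕ) :
    Module.finrank ℂ (homogeneousSubmodule (Fin 2) ℂ k) = k + 1 := by
  have h : homogeneousSubmodule (Fin 2) ℂ k =
      (Polynomial.degreeLT ℂ (k + 1)).map (Polynomial.homogenizeLM k) := by
    ext φ
    rw [Submodule.mem_map]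
    constructor
    · intro hφ
      refine ⟨∑ i ∈ Finset.range (k + 1),
        Polynomial.monomial i (coeff (Finsupp.single 0 i + Finsupp.single 1 (k - i)) φ), ?_, ?_⟩
      · refine Submodule.sum_mem _ fun i hi => ?_
        rw [Polynomial.mem_degreeLT]
        refine lt_of_le_of_lt (Polynomial.degree_monomial_le _ _) ?_
        exact_mod_cast Finset.mem_range.1 hi
      · ext m
        change coeff m (Polynomial.homogenize _ k) = _
        rw [Polynomial.coeff_homogenize]
        split_ifs with hm
        · rw [Polynomial.finsetSum_coeff]
          simp_rw [Polynomial.coeff_monomial]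
          rw [Finset.sum_ite_eq', if_pos (Finset.mem_range.2 (by omega))]
          congr 1
          ext i
          fin_cases i
          · simp
          · simp; omega
        · refine (IsHomogeneous.coeff_eq_zero hφ ?_).symm
          rwa [Finsupp.degree_eq_sum, Fin.sum_univ_two]
    · rintro ⟨P, -, rfl⟩
      exact Polynomial.isHomogeneous_homogenize P
  rw [h, ← LinearMap.range_domRestrict, LinearMap.finrank_range_of_inj]
  · rw [(Polynomial.degreeLTEquiv ℂ (k + 1)).finrank_eq, Module.finrank_fin_fun]
  · rw [injective_iff_map_eq_zero]
    rintro ⟨P, hP⟩ h0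
    refine Subtype.ext (Polynomial.eq_zero_of_homogenize_eq_zero (n := k) ?_ h0)
    rw [Polynomial.mem_degreeLT] at hP
    by_cases hP0 : P = 0
    · simp [hP0]
    · exact Nat.lt_succ_iff.1 ((Polynomial.natDegree_lt_iff_degree_lt hP0).2 hP)

instance (k : ℕ) : FiniteDimensional ℂ (homogeneousSubmodule (Fin 2) ℂ k) :=
  FiniteDimensional.of_finrank_pos (by rw [finrank_homogeneousSubmodule_fin_two]; omega)

theorem eq_zero_of_isHomogeneous_of_dvd {a l : ℕ} {α v : MvPolynomial (Fin 2) ℂ}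
    (hα : α.IsHomogeneous a) (hv : v.IsHomogeneous l) (hl : l < a) (h : α ∣ v) : v = 0 := by
  obtain ⟨w, rfl⟩ := h
  by_contra h0
  exact absurd (le_of_isHomogeneous_mul hα hv h0) (not_le.2 hl)

theorem isUnit_of_isHomogeneous_zero {α : MvPolynomial (Fin 2) ℂ} (hα : α.IsHomogeneous 0)
    (h0 : α ≠ 0) : IsUnit α := by
  rw [← totalDegree_zero_iff_isHomogeneous, totalDegree_eq_zero_iff_eq_C] at hα
  rw [hα] at h0 ⊢
  exact (isUnit_iff_ne_zero.2 fun h => h0 (by rw [h, C_0])).map C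

theorem exists_ne_zero_eval_eq_zero {k : ℕ} {φ : MvPolynomial (Fin 2) ℂ}
    (hφ : φ.IsHomogeneous (k + 1)) : ∃ p : Fin 2 → ℂ, p ≠ 0 ∧ eval p φ = 0 := by
  obtain ⟨p, hp, h⟩ := exists_eval_eq_zero_s11 hφ
  refine ⟨p, ?_, h⟩
  rintro rfl
  rcases hp with hp | ⟨a, hp⟩
  · simpa using congrFun hp 0
  · simpa using congrFun hp 1

/-- Two polynomials without common zeros outside the origin. -/
def NoCommonZeros (α β : MvPolynomial (Fin 2) ℂ) : Prop :=
  ∀ p : Fin 2 → ℂ, p ≠ 0 → ¬ (eval p α = 0 ∧ eval p β = 0)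

theorem NoCommonZeros.dvd_of_dvd_mul {a l : ℕ} {α β v : MvPolynomial (Fin 2) ℂ}
    (h : NoCommonZeros α β) (hα : α.IsHomogeneous a) (hα0 : α ≠ 0)
    (hv : v.IsHomogeneous l) (hd : α ∣ v * β) : α ∣ v := by
  induction a generalizing α v l with
  | zero => exact (isUnit_of_isHomogeneous_zero hα hα0).dvd
  | succ a ih =>
    obtain ⟨p, hp, hpα⟩ := exists_ne_zero_eval_eq_zero hα
    have hpv : eval p v = 0 := by
      obtain ⟨w, hw⟩ := hd
      have := congrArg (eval p) hw
      rw [map_mul, map_mul, hpα, zero_mul, mul_eq_zero] at this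
      exact this.resolve_right fun h' => h p hp ⟨hpα, h'⟩
    obtain ⟨α', hα', rfl⟩ := exists_eq_vanishingForm_mul hα hp hpα
    obtain ⟨v', rfl⟩ := vanishingForm_dvd hv hp hpv
    rcases eq_or_ne v' 0 with rfl | hv0
    · simp
    have hl := le_of_isHomogeneous_mul (vanishingForm_isHomogeneous p) hv
      (mul_ne_zero (vanishingForm_ne_zero hp) hv0)
    obtain ⟨l, rfl⟩ := Nat.exists_eq_add_of_le hl
    have hv' := isHomogeneous_of_mul_left (vanishingForm_isHomogeneous p)
      (vanishingForm_ne_zero hp) hv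
    refine mul_dvd_mul_left _ (ih (fun q hq hz => h q hq ⟨?_, hz.2⟩) hα'
      (right_ne_zero_of_mul hα0) hv' ?_)
    · rw [map_mul, hz.1, mul_zero]
    · rw [mul_assoc] at hd
      exact (mul_dvd_mul_iff_left (vanishingForm_ne_zero hp)).1 hd

/-- The map `(u, v) ↦ u α + v β` on pairs of forms of degrees `i` and `j`. -/
noncomputable def pairMap (α β : MvPolynomial (Fin 2) ℂ) (i j : ℕ) :
    homogeneousSubmodule (Fin 2) ℂ i × homogeneousSubmodule (Fin 2) ℂ j →ₗ[ℂ]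
      MvPolynomial (Fin 2) ℂ :=
  (LinearMap.mulRight ℂ α ∘ₗ Submodule.subtype _).coprod
    (LinearMap.mulRight ℂ β ∘ₗ Submodule.subtype _)

theorem pairMap_apply (α β : MvPolynomial (Fin 2) ℂ) (i j : ℕ)
    (x : homogeneousSubmodule (Fin 2) ℂ i × homogeneousSubmodule (Fin 2) ℂ j) :
    pairMap α β i j x = (x.1 : MvPolynomial (Fin 2) ℂ) * α + (x.2 : MvPolynomial (Fin 2) ℂ) * β :=
  rfl

theorem NoCommonZeros.finrank_range_pairMap {a i j : ℕ} {α β : MvPolynomial (Fin 2) ℂ}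
    (h : NoCommonZeros α β) (hα : α.IsHomogeneous a) (hα0 : α ≠ 0)
    (hj : j < a) :
    Module.finrank ℂ (LinearMap.range (pairMap α β i j)) = i + j + 2 := by
  rw [LinearMap.finrank_range_of_inj, Module.finrank_prod, finrank_homogeneousSubmodule_fin_two,
    finrank_homogeneousSubmodule_fin_two]
  · omega
  rw [injective_iff_map_eq_zero]
  rintro ⟨⟨u, hu⟩, ⟨v, hv⟩⟩ h0
  rw [pairMap_apply] at h0
  simp only at h0
  have hv0 : v = 0 := eq_zero_of_isHomogeneous_of_dvd hα hv hj
    (h.dvd_of_dvd_mul hα hα0 hv ⟨-u, by linear_combination h0⟩)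
  subst hv0
  have hu0 : u = 0 := by simpa [hα0] using h0
  subst hu0
  rfl

theorem pairMap_mem_span (α β : MvPolynomial (Fin 2) ℂ) (i j : ℕ)
    (x : homogeneousSubmodule (Fin 2) ℂ i × homogeneousSubmodule (Fin 2) ℂ j) :
    pairMap α β i j x ∈ Ideal.span {α, β} :=
  Ideal.mem_span_pair.2 ⟨_, _, rfl⟩

theorem range_pairMap_le {a b i j k : ℕ} {α β : MvPolynomial (Fin 2) ℂ}
    (hα : α.IsHomogeneous a) (hβ : β.IsHomogeneous b) (hi : i + a = k) (hj : j + b = k) :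
    LinearMap.range (pairMap α β i j) ≤ homogeneousSubmodule (Fin 2) ℂ k := by
  rintro _ ⟨⟨⟨u, hu⟩, ⟨v, hv⟩⟩, rfl⟩
  rw [pairMap_apply]
  exact Submodule.add_mem _ (hi ▸ IsHomogeneous.mul hu hα) (hj ▸ IsHomogeneous.mul hv hβ)

theorem NoCommonZeros.mem_span_of_isHomogeneous {a b k : ℕ} {α β φ : MvPolynomial (Fin 2) ℂ}
    (h : NoCommonZeros α β) (hα : α.IsHomogeneous (a + 1)) (hα0 : α ≠ 0)
    (hβ : β.IsHomogeneous (b + 1)) (hk : a + b + 1 ≤ k) (hφ : φ.IsHomogeneous k) :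
    φ ∈ Ideal.span {α, β} := by
  induction k, hk using Nat.le_induction generalizing φ with
  | base =>
    have hle := range_pairMap_le (i := b) (j := a) (k := a + b + 1) hα hβ (by omega) (by omega)
    have heq := Submodule.eq_of_le_of_finrank_le hle (by
      rw [h.finrank_range_pairMap hα hα0 (Nat.lt_succ_self a),
        finrank_homogeneousSubmodule_fin_two]
      omega)
    have hmem : φ ∈ LinearMap.range (pairMap α β b a) := heq ▸ hφ
    obtain ⟨x, rfl⟩ := hmem
    exact pairMap_mem_span α β _ _ x
  | succ k hk ih =>
    have hE := hφ.sum_X_mul_pderiv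
    have hφ' : φ = C ((k + 1 : ℂ)⁻¹) * ∑ i, X i * pderiv i φ := by
      have hC : (C ((k + 1 : ℂ)⁻¹) : MvPolynomial (Fin 2) ℂ) * (k + 1) = 1 := by
        rw [show (k + 1 : MvPolynomial (Fin 2) ℂ) = C (k + 1 : ℂ) by simp, ← C_mul,
          inv_mul_cancel₀ (by exact_mod_cast k.succ_ne_zero), C_1]
      rw [hE, nsmul_eq_mul, ← mul_assoc]
      push_cast
      rw [hC, one_mul]
    rw [hφ']
    exact Ideal.mul_mem_left _ _ (Ideal.sum_mem _ fun i _ =>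
      Ideal.mul_mem_left _ _ (ih hφ.pderiv))

theorem exists_isHomogeneous_of_mem_span_pair {a b k : ℕ} {α β φ : MvPolynomial (Fin 2) ℂ}
    (hα : α.IsHomogeneous a) (hβ : β.IsHomogeneous b) (hφ : φ.IsHomogeneous k)
    (h : φ ∈ Ideal.span {α, β}) :
    ∃ u v, u * α + v * β = φ ∧ v.IsHomogeneous (k - b) ∧ (k < b → v = 0) := by
  obtain ⟨u, v, huv⟩ := Ideal.mem_span_pair.1 h
  have h1 := homogeneousComponent_mul_of_left hα u k
  have h2 := homogeneousComponent_mul_of_left hβ v k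
  have h3 : homogeneousComponent k (α * u) + homogeneousComponent k (β * v) = φ := by
    rw [← map_add, mul_comm α, mul_comm β, huv, homogeneousComponent_eq_self hφ]
  rw [h1, h2] at h3
  refine ⟨if a ≤ k then homogeneousComponent (k - a) u else 0,
    if b ≤ k then homogeneousComponent (k - b) v else 0, ?_, ?_, ?_⟩
  · rw [← h3]
    split_ifs <;> ring
  · split_ifs
    · exact homogeneousComponent_isHomogeneous _ _
    · exact isHomogeneous_zero _ _ _
  · intro hk
    rw [if_neg (not_le.2 hk)]

theorem exists_of_X_zero_mul_eq {v w : MvPolynomial (Fin 2) ℂ} (h : X 0 * w = X 1 * v) :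
    ∃ z, v = X 0 * z ∧ w = X 1 * z := by
  have h1 : (X 0 : MvPolynomial (Fin 2) ℂ) ∣ X 1 * v := ⟨w, h.symm⟩
  rcases (X_prime (i := (0 : Fin 2))).dvd_or_dvd h1 with h2 | ⟨z, rfl⟩
  · rw [X_dvd_X] at h2
    simp at h2
  · refine ⟨z, rfl, mul_left_cancel₀ (X_ne_zero (0 : Fin 2)) ?_⟩
    rw [h]
    ring

/-- The socle of a complete intersection of binary forms of degrees `a` and `b` lives in
degree `a + b - 2`. -/
theorem NoCommonZeros.mem_span_of_X_mul_mem {a b k : ℕ} {α β φ : MvPolynomial (Fin 2) ℂ}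
    (h : NoCommonZeros α β) (hα : α.IsHomogeneous a) (hα0 : α ≠ 0)
    (hβ : β.IsHomogeneous b) (hφ : φ.IsHomogeneous k) (hk : k + 2 < a + b)
    (hX : ∀ i, X i * φ ∈ Ideal.span {α, β}) : φ ∈ Ideal.span {α, β} := by
  have hXφ : ∀ i : Fin 2, (X i * φ).IsHomogeneous (k + 1) := fun i => by
    rw [add_comm]
    exact (isHomogeneous_X ℂ i).mul hφ
  obtain ⟨u, v, huv, hv, hv0⟩ := exists_isHomogeneous_of_mem_span_pair hα hβ (hXφ 0) (hX 0)
  obtain ⟨u', v', huv', hv', hv0'⟩ := exists_isHomogeneous_of_mem_span_pair hα hβ (hXφ 1) (hX 1)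
  have hvv : X 0 * v' - X 1 * v = 0 := by
    by_cases hkb : k + 1 < b
    · rw [hv0 hkb, hv0' hkb]
      ring
    · have hhom : (X 0 * v' - X 1 * v).IsHomogeneous (1 + (k + 1 - b)) :=
        ((isHomogeneous_X ℂ _).mul hv').sub ((isHomogeneous_X ℂ _).mul hv)
      refine eq_zero_of_isHomogeneous_of_dvd hα hhom (by omega) (h.dvd_of_dvd_mul hα hα0 hhom ?_)
      exact ⟨X 1 * u - X 0 * u', by linear_combination X 0 * huv' - X 1 * huv⟩
  have huu : X 0 * u' = X 1 * u := by
    refine mul_right_cancel₀ hα0 ?_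
    linear_combination X 0 * huv' - X 1 * huv - β * hvv
  obtain ⟨z, hz, -⟩ := exists_of_X_zero_mul_eq huu
  obtain ⟨w, hw, -⟩ := exists_of_X_zero_mul_eq (sub_eq_zero.1 hvv)
  refine Ideal.mem_span_pair.2 ⟨z, w, mul_left_cancel₀ (X_ne_zero (0 : Fin 2)) ?_⟩
  rw [← huv, hz, hw]
  ring


/-- The ideal of polynomials all of whose multiples are killed by the linear functional `Λ`. -/
noncomputable def apolarIdeal (Λ : MvPolynomial (Fin 2) ℂ →ₗ[ℂ] ℂ) :
    Ideal (MvPolynomial (Fin 2) ℂ) where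
  carrier := {φ | ∀ θ, Λ (θ * φ) = 0}
  add_mem' h h' θ := by rw [mul_add, map_add, h θ, h' θ, add_zero]
  zero_mem' θ := by rw [mul_zero, map_zero]
  smul_mem' c φ h θ := by rw [smul_eq_mul, ← mul_assoc]; exact h _

theorem mem_apolarIdeal {Λ : MvPolynomial (Fin 2) ℂ →ₗ[ℂ] ℂ} {φ : MvPolynomial (Fin 2) ℂ} :
    φ ∈ apolarIdeal Λ ↔ ∀ θ, Λ (θ * φ) = 0 :=
  Iff.rfl

/-- The linear functional `Λ` only depends on the degree `n` component. -/
def ConcentratedIn (Λ : MvPolynomial (Fin 2) ℂ →ₗ[ℂ] ℂ) (n : ℕ) : Prop :=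
  ∀ θ, Λ (homogeneousComponent n θ) = Λ θ

section Functional

variable {Λ : MvPolynomial (Fin 2) ℂ →ₗ[ℂ] ℂ} {n : ℕ}

theorem ConcentratedIn.mem_apolarIdeal_iff (hΛ : ConcentratedIn Λ n) {k : ℕ}
    {φ : MvPolynomial (Fin 2) ℂ} (hφ : φ.IsHomogeneous k) :
    φ ∈ apolarIdeal Λ ↔ ∀ j θ, j + k = n → θ.IsHomogeneous j → Λ (θ * φ) = 0 := by
  refine ⟨fun h j θ _ _ => h θ, fun h θ => ?_⟩
  rw [← hΛ, mul_comm, homogeneousComponent_mul_of_left hφ]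
  split_ifs with hk
  · rw [mul_comm]
    exact h (n - k) _ (by omega) (homogeneousComponent_isHomogeneous _ _)
  · exact map_zero Λ

theorem ConcentratedIn.mem_apolarIdeal_of_lt (hΛ : ConcentratedIn Λ n) {k : ℕ} (hk : n < k)
    {φ : MvPolynomial (Fin 2) ℂ} (hφ : φ.IsHomogeneous k) : φ ∈ apolarIdeal Λ :=
  (hΛ.mem_apolarIdeal_iff hφ).2 fun _ _ h _ => absurd h (by omega)

theorem ConcentratedIn.homogeneousComponent_mem_apolarIdeal (hΛ : ConcentratedIn Λ n)
    {φ : MvPolynomial (Fin 2) ℂ} (hφ : φ ∈ apolarIdeal Λ) (k : ℕ) :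
    homogeneousComponent k φ ∈ apolarIdeal Λ := by
  rw [hΛ.mem_apolarIdeal_iff (homogeneousComponent_isHomogeneous k φ)]
  intro j θ hjk hθ
  have h := homogeneousComponent_mul_of_left hθ φ n
  rw [if_pos (by omega), show n - j = k by omega] at h
  rw [← h, hΛ]
  exact hφ θ

theorem ConcentratedIn.comp_mulLeft (hΛ : ConcentratedIn Λ (n + 1))
    {l : MvPolynomial (Fin 2) ℂ} (hl : l.IsHomogeneous 1) :
    ConcentratedIn (Λ ∘ₗ LinearMap.mulLeft ℂ l) n := by
  intro θ
  have h := homogeneousComponent_mul_of_left hl θ (n + 1)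
  rw [if_pos (by omega), Nat.add_sub_cancel] at h
  simp only [LinearMap.comp_apply, LinearMap.mulLeft_apply]
  rw [← h, hΛ]

theorem mem_apolarIdeal_comp_mulLeft {l φ : MvPolynomial (Fin 2) ℂ} :
    φ ∈ apolarIdeal (Λ ∘ₗ LinearMap.mulLeft ℂ l) ↔ l * φ ∈ apolarIdeal Λ := by
  simp only [mem_apolarIdeal, LinearMap.comp_apply, LinearMap.mulLeft_apply]
  exact forall_congr' fun θ => by rw [mul_left_comm]

theorem eq_zero_of_one_mem_apolarIdeal (h : 1 ∈ apolarIdeal Λ) : Λ = 0 := by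
  refine LinearMap.ext fun θ => ?_
  simpa using h θ

/-- No nonzero form of degree less than `s` is apolar to `Λ`. -/
def NoApolarBelow (Λ : MvPolynomial (Fin 2) ℂ →ₗ[ℂ] ℂ) (s : ℕ) : Prop :=
  ∀ j φ, j < s → φ.IsHomogeneous j → φ ∈ apolarIdeal Λ → φ = 0

theorem NoApolarBelow.comp_mulLeft {s : ℕ} (hs : NoApolarBelow Λ (s + 1))
    {l : MvPolynomial (Fin 2) ℂ} (hl : l.IsHomogeneous 1) (hl0 : l ≠ 0) :
    NoApolarBelow (Λ ∘ₗ LinearMap.mulLeft ℂ l) s := by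
  intro j φ hj hφ hmem
  have h := hs (1 + j) (l * φ) (by omega) (hl.mul hφ) (mem_apolarIdeal_comp_mulLeft.1 hmem)
  exact (mul_eq_zero.1 h).resolve_left hl0

/-- If dividing out a common zero of `α` and `φ` leads to forms of degrees `s` and `k` for which
divisibility is known, then `α ∣ φ`. -/
theorem dvd_of_common_zero {s k : ℕ}
    (ih : ∀ (n k : ℕ) (Λ : MvPolynomial (Fin 2) ℂ →ₗ[ℂ] ℂ) (α φ : MvPolynomial (Fin 2) ℂ),
      ConcentratedIn Λ n → Λ ≠ 0 → α.IsHomogeneous s → α ≠ 0 → α ∈ apolarIdeal Λ →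
      NoApolarBelow Λ s → φ.IsHomogeneous k → φ ∈ apolarIdeal Λ → s + k ≤ n + 1 → α ∣ φ)
    {α φ : MvPolynomial (Fin 2) ℂ} (hΛ : ConcentratedIn Λ n)
    (hα : α.IsHomogeneous (s + 1)) (hα0 : α ≠ 0) (hαΛ : α ∈ apolarIdeal Λ)
    (hs : NoApolarBelow Λ (s + 1)) (hφ : φ.IsHomogeneous (k + 1)) (hφΛ : φ ∈ apolarIdeal Λ)
    (hk : s + k ≤ n) (hz : ¬ NoCommonZeros α φ) : α ∣ φ := by
  simp only [NoCommonZeros, not_forall, not_not] at hz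
  obtain ⟨p, hp, hpα, hpφ⟩ := hz
  obtain ⟨α', hα', rfl⟩ := exists_eq_vanishingForm_mul hα hp hpα
  obtain ⟨φ', hφ', rfl⟩ := exists_eq_vanishingForm_mul hφ hp hpφ
  refine mul_dvd_mul_left _ ?_
  have hα'0 := right_ne_zero_of_mul hα0
  rcases Nat.eq_zero_or_pos s with rfl | hs0
  · exact (isUnit_of_isHomogeneous_zero hα' hα'0).dvd
  obtain ⟨n, rfl⟩ : ∃ m, n = m + 1 := ⟨n - 1, by omega⟩
  have hl := vanishingForm_isHomogeneous p
  have hl0 := vanishingForm_ne_zero hp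
  refine ih n k (Λ ∘ₗ LinearMap.mulLeft ℂ (vanishingForm p)) α' φ' (hΛ.comp_mulLeft hl) ?_ hα'
    hα'0 (mem_apolarIdeal_comp_mulLeft.2 hαΛ) (hs.comp_mulLeft hl hl0) hφ'
    (mem_apolarIdeal_comp_mulLeft.2 hφΛ) (by omega)
  intro h0
  refine hl0 (hs 1 _ (by omega) hl fun θ => ?_)
  rw [mul_comm]
  exact LinearMap.congr_fun h0 θ

/-- In small degrees every apolar form is a multiple of the apolar form of minimal degree. -/
theorem ConcentratedIn.dvd_of_add_le {s k : ℕ} {α φ : MvPolynomial (Fin 2) ℂ}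
    (hΛ : ConcentratedIn Λ n) (hΛ0 : Λ ≠ 0)
    (hα : α.IsHomogeneous s) (hα0 : α ≠ 0) (hαΛ : α ∈ apolarIdeal Λ) (hs : NoApolarBelow Λ s)
    (hφ : φ.IsHomogeneous k) (hφΛ : φ ∈ apolarIdeal Λ) (hk : s + k ≤ n + 1) : α ∣ φ := by
  induction s generalizing n k Λ α φ with
  | zero => exact (isUnit_of_isHomogeneous_zero hα hα0).dvd
  | succ s ih =>
    rcases k with _ | k
    · rw [hs 0 φ s.succ_pos hφ hφΛ]
      exact dvd_zero α
    refine dvd_of_common_zero (k := k) (fun n k Λ α φ h1 h2 h3 h4 h5 h6 h7 h8 h9 =>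
      ih h1 h2 h3 h4 h5 h6 h7 h8 h9) hΛ hα hα0 hαΛ hs hφ hφΛ (by omega) fun hz => hΛ0 ?_
    refine LinearMap.ext fun θ => ?_
    rw [← hΛ]
    have hle : Ideal.span {α, φ} ≤ apolarIdeal Λ := by
      rw [Ideal.span_le]
      rintro _ (rfl | rfl)
      exacts [hαΛ, hφΛ]
    have := hle (hz.mem_span_of_isHomogeneous hα hα0 hφ (by omega)
      (homogeneousComponent_isHomogeneous n θ)) 1
    rwa [one_mul] at this

theorem ConcentratedIn.dvd_of_not_noCommonZeros {s k : ℕ} {α φ : MvPolynomial (Fin 2) ℂ}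
    (hΛ : ConcentratedIn Λ n)
    (hα : α.IsHomogeneous (s + 1)) (hα0 : α ≠ 0) (hαΛ : α ∈ apolarIdeal Λ)
    (hs : NoApolarBelow Λ (s + 1)) (hφ : φ.IsHomogeneous (k + 1)) (hφΛ : φ ∈ apolarIdeal Λ)
    (hk : s + k ≤ n) (hz : ¬ NoCommonZeros α φ) : α ∣ φ :=
  dvd_of_common_zero (fun _ _ _ _ _ h1 h2 h3 h4 h5 h6 h7 h8 h9 =>
    h1.dvd_of_add_le h2 h3 h4 h5 h6 h7 h8 h9) hΛ hα hα0 hαΛ hs hφ hφΛ hk hz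

/-- Multiplication of forms of complementary degrees followed by `Λ`. -/
noncomputable def catalecticant (Λ : MvPolynomial (Fin 2) ℂ →ₗ[ℂ] ℂ) (k j : ℕ) :
    homogeneousSubmodule (Fin 2) ℂ k →ₗ[ℂ]
      Module.Dual ℂ (homogeneousSubmodule (Fin 2) ℂ j) :=
  LinearMap.domRestrict₁₂ (LinearMap.mul ℂ (MvPolynomial (Fin 2) ℂ)).flip _ _ |>.compr₂ Λ

theorem ConcentratedIn.mem_apolarIdeal_of_catalecticant_eq_zero (hΛ : ConcentratedIn Λ n)
    {k j : ℕ} (hjk : j + k = n) {φ : homogeneousSubmodule (Fin 2) ℂ k}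
    (h : catalecticant Λ k j φ = 0) : (φ : MvPolynomial (Fin 2) ℂ) ∈ apolarIdeal Λ := by
  refine (hΛ.mem_apolarIdeal_iff φ.2).2 fun i θ hi hθ => ?_
  obtain rfl : i = j := by omega
  exact LinearMap.congr_fun h ⟨θ, hθ⟩

theorem ConcentratedIn.exists_mem_apolarIdeal (hΛ : ConcentratedIn Λ n) {k : ℕ}
    (hk : n < 2 * k) : ∃ φ, φ.IsHomogeneous k ∧ φ ≠ 0 ∧ φ ∈ apolarIdeal Λ := by
  rcases lt_or_ge n k with h | h
  · exact ⟨X 0 ^ k, isHomogeneous_X_pow 0 k, pow_ne_zero k (X_ne_zero _),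
      hΛ.mem_apolarIdeal_of_lt h (isHomogeneous_X_pow 0 k)⟩
  · have hker : LinearMap.ker (catalecticant Λ k (n - k)) ≠ ⊥ :=
      LinearMap.ker_ne_bot_of_finrank_lt (by
        rw [Subspace.dual_finrank_eq, finrank_homogeneousSubmodule_fin_two,
          finrank_homogeneousSubmodule_fin_two]
        omega)
    obtain ⟨φ, hφ, hφ0⟩ := Submodule.exists_mem_ne_zero_of_ne_bot hker
    exact ⟨φ, φ.2, fun h => hφ0 (Subtype.ext h),
      hΛ.mem_apolarIdeal_of_catalecticant_eq_zero (by omega) hφ⟩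

theorem ConcentratedIn.exists_not_dvd (hΛ : ConcentratedIn Λ n) {s : ℕ} (hs1 : 1 ≤ s)
    (hsn : 2 * s ≤ n + 2) {α : MvPolynomial (Fin 2) ℂ} (hα : α.IsHomogeneous s) :
    ∃ β, β.IsHomogeneous (n + 2 - s) ∧ β ∈ apolarIdeal Λ ∧ ¬ α ∣ β := by
  by_contra! hcon
  set b := n + 2 - s with hb
  set V : Submodule ℂ (homogeneousSubmodule (Fin 2) ℂ b) :=
    ((apolarIdeal Λ).restrictScalars ℂ).comap (Submodule.subtype _) with hV
  have hlow : n + 4 - 2 * s ≤ Module.finrank ℂ V := by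
    rcases hs1.eq_or_lt with rfl | hs2
    · have : V = ⊤ := by
        rw [eq_top_iff]
        intro φ _
        exact hΛ.mem_apolarIdeal_of_lt (k := b) (by omega) φ.2
      rw [this, finrank_top, finrank_homogeneousSubmodule_fin_two]
      omega
    · have hle : LinearMap.ker (catalecticant Λ b (s - 2)) ≤ V := fun φ hφ =>
        hΛ.mem_apolarIdeal_of_catalecticant_eq_zero (by omega) hφ
      have h1 := Submodule.finrank_mono hle
      have h2 := LinearMap.finrank_range_add_finrank_ker (catalecticant Λ b (s - 2))
      have h3 := Submodule.finrank_le (LinearMap.range (catalecticant Λ b (s - 2)))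
      rw [Subspace.dual_finrank_eq, finrank_homogeneousSubmodule_fin_two] at h3
      rw [finrank_homogeneousSubmodule_fin_two] at h2
      omega
  set W : Submodule ℂ (MvPolynomial (Fin 2) ℂ) :=
    LinearMap.range (LinearMap.mulLeft ℂ α ∘ₗ
      Submodule.subtype (homogeneousSubmodule (Fin 2) ℂ (b - s))) with hW
  have hup : Module.finrank ℂ W ≤ b - s + 1 :=
    (LinearMap.finrank_range_le _).trans (finrank_homogeneousSubmodule_fin_two _).le
  have hVW : V.map (Submodule.subtype _) ≤ W := by
    rintro _ ⟨φ, hφ, rfl⟩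
    obtain ⟨ψ, hψ⟩ := hcon φ φ.2 hφ
    have h := homogeneousComponent_mul_of_left hα ψ b
    rw [← hψ, homogeneousComponent_eq_self φ.2, if_pos (by omega)] at h
    exact ⟨⟨homogeneousComponent (b - s) ψ, homogeneousComponent_isHomogeneous _ _⟩, h.symm⟩
  have h := Submodule.finrank_mono hVW
  rw [Submodule.finrank_map_subtype_eq] at h
  omega

/-- The structure theorem for apolar ideals of functionals on binary forms. -/
theorem ConcentratedIn.exists_generators (hΛ : ConcentratedIn Λ n) (hΛ0 : Λ ≠ 0) {s : ℕ}
    {α : MvPolynomial (Fin 2) ℂ} (hα : α.IsHomogeneous s) (hα0 : α ≠ 0)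
    (hαΛ : α ∈ apolarIdeal Λ) (hs : NoApolarBelow Λ s) :
    ∃ β, β.IsHomogeneous (n + 2 - s) ∧ apolarIdeal Λ = Ideal.span {α, β} ∧
      NoCommonZeros α β := by
  have hs1 : 1 ≤ s := by
    by_contra h
    obtain rfl : s = 0 := by omega
    refine hΛ0 (eq_zero_of_one_mem_apolarIdeal ?_)
    rw [Ideal.eq_top_of_isUnit_mem _ hαΛ (isUnit_of_isHomogeneous_zero hα hα0)]
    exact Submodule.mem_top
  have hsn : 2 * s ≤ n + 2 := by
    by_contra h
    obtain ⟨φ, hφ, hφ0, hφΛ⟩ := hΛ.exists_mem_apolarIdeal (k := n / 2 + 1) (by omega)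
    exact hφ0 (hs _ φ (by omega) hφ hφΛ)
  obtain ⟨β, hβ, hβΛ, hαβ⟩ := hΛ.exists_not_dvd hs1 hsn hα
  obtain ⟨a, rfl⟩ : ∃ a, s = a + 1 := ⟨s - 1, by omega⟩
  obtain ⟨b, hb⟩ : ∃ b, n + 2 - (a + 1) = b + 1 := ⟨n - a, by omega⟩
  have hz : NoCommonZeros α β := by
    by_contra hz
    rw [hb] at hβ
    exact hαβ (hΛ.dvd_of_not_noCommonZeros hα hα0 hαΛ hs hβ hβΛ (by omega) hz)
  refine ⟨β, hβ, le_antisymm ?_ ?_, hz⟩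
  · rw [hb] at hβ
    have htop : ∀ φ, φ.IsHomogeneous n → φ ∈ apolarIdeal Λ → φ ∈ Ideal.span {α, β} := by
      intro φ hφ hφΛ
      rcases Nat.eq_zero_or_pos a with rfl | ha
      · exact Ideal.mem_of_dvd _ (hΛ.dvd_of_add_le hΛ0 hα hα0 hαΛ hs hφ hφΛ (by omega))
          (Ideal.subset_span (by simp))
      · set W : Submodule ℂ (MvPolynomial (Fin 2) ℂ) :=
          homogeneousSubmodule (Fin 2) ℂ n ⊓ LinearMap.ker Λ with hW
        have hlt : W < homogeneousSubmodule (Fin 2) ℂ n := by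
          refine lt_of_le_of_ne inf_le_left fun h => hΛ0 (LinearMap.ext fun θ => ?_)
          rw [← hΛ]
          exact ((h.symm ▸ homogeneousComponent_mem n θ : homogeneousComponent n θ ∈ W)).2
        have hfin := Submodule.finrank_lt_finrank_of_lt hlt
        rw [finrank_homogeneousSubmodule_fin_two] at hfin
        have hle : LinearMap.range (pairMap α β (b - 1) (a - 1)) ≤ W := by
          refine le_inf (range_pairMap_le hα hβ (by omega) (by omega)) ?_
          rintro _ ⟨x, rfl⟩
          rw [LinearMap.mem_ker, pairMap_apply, map_add, hαΛ, hβΛ, add_zero]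
        have : FiniteDimensional ℂ W := Submodule.finiteDimensional_of_le hlt.le
        have heq := Submodule.eq_of_le_of_finrank_le hle (by
          rw [hz.finrank_range_pairMap hα hα0 (by omega)]
          omega)
        have hφW : φ ∈ W := ⟨hφ, by simpa using hφΛ 1⟩
        rw [← heq] at hφW
        obtain ⟨x, rfl⟩ := hφW
        exact pairMap_mem_span α β _ _ x
    have hdesc : ∀ d k φ, k + d = n → φ.IsHomogeneous k → φ ∈ apolarIdeal Λ →
        φ ∈ Ideal.span {α, β} := by
      intro d
      induction d with
      | zero =>
        intro k φ hk hφ hφΛ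
        obtain rfl : k = n := hk
        exact htop φ hφ hφΛ
      | succ d ih =>
        intro k φ hk hφ hφΛ
        refine hz.mem_span_of_X_mul_mem hα hα0 hβ hφ (by omega) fun i => ?_
        refine ih (1 + k) _ (by omega) ((isHomogeneous_X ℂ i).mul hφ) ?_
        exact Ideal.mul_mem_left _ _ hφΛ
    intro φ hφ
    rw [← sum_homogeneousComponent φ]
    refine Ideal.sum_mem _ fun k _ => ?_
    have hk := homogeneousComponent_isHomogeneous k φ
    rcases le_or_gt k n with h | h
    · exact hdesc (n - k) k _ (by omega) hk (hΛ.homogeneousComponent_mem_apolarIdeal hφ k)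
    · exact hz.mem_span_of_isHomogeneous hα hα0 hβ (by omega) hk
  · rw [Ideal.span_le]
    rintro _ (rfl | rfl)
    exacts [hαΛ, hβΛ]

end Functional

open Nat in
/-- The apolarity pairing of a polynomial with differential operators, as a functional. -/
noncomputable def apolarForm :
    MvPolynomial (Fin 2) ℂ →ₗ[ℂ] MvPolynomial (Fin 2) ℂ →ₗ[ℂ] ℂ :=
  ((basisMonomials (Fin 2) ℂ).constr ℂ).toLinearMap ∘ₗ
    LinearMap.pi fun a => (((a 0)! * (a 1)! : ℕ) : ℂ) • lcoeff ℂ a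

open Nat in
theorem apolarForm_monomial (f : MvPolynomial (Fin 2) ℂ) (a : Fin 2 →₀ ℕ) (c : ℂ) :
    apolarForm f (monomial a c) = c * (((a 0)! * (a 1)! : ℕ) * coeff a f) := by
  have h : monomial a c = c • basisMonomials (Fin 2) ℂ a := by
    rw [coe_basisMonomials, smul_monomial, smul_eq_mul, mul_one]
  rw [h, map_smul, apolarForm, LinearMap.comp_apply, LinearEquiv.coe_coe,
    Module.Basis.constr_basis]
  simp [lcoeff]

theorem ext_monomial {Λ Λ' : MvPolynomial (Fin 2) ℂ →ₗ[ℂ] ℂ}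
    (h : ∀ a, Λ (monomial a 1) = Λ' (monomial a 1)) : Λ = Λ' :=
  (basisMonomials (Fin 2) ℂ).ext fun a => by simpa using h a

theorem apolarForm_injective : Function.Injective apolarForm := by
  intro f f' h
  ext a
  have h1 := LinearMap.congr_fun h (monomial a 1)
  rw [apolarForm_monomial, apolarForm_monomial, one_mul, one_mul] at h1
  exact mul_left_cancel₀ (Nat.cast_ne_zero.2 (by positivity)) h1

theorem apolarForm_pderiv (i : Fin 2) (f θ : MvPolynomial (Fin 2) ℂ) :
    apolarForm (pderiv i f) θ = apolarForm f (θ * X i) := by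
  have h : apolarForm (pderiv i f) = apolarForm f ∘ₗ LinearMap.mulRight ℂ (X i) := by
    refine ext_monomial fun a => ?_
    rw [LinearMap.comp_apply, LinearMap.mulRight_apply, X, monomial_mul, apolarForm_monomial,
      apolarForm_monomial, coeff_pderiv]
    fin_cases i <;> simp [Nat.factorial_succ] <;> ring
  rw [h, LinearMap.comp_apply, LinearMap.mulRight_apply]

theorem apolarForm_iterate_pderiv (i : Fin 2) (k : ℕ) (f θ : MvPolynomial (Fin 2) ℂ) :
    apolarForm ((fun p => pderiv i p)^[k] f) θ = apolarForm f (θ * X i ^ k) := by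
  induction k generalizing f with
  | zero => simp
  | succ k ih => rw [Function.iterate_succ_apply, ih, apolarForm_pderiv, mul_assoc, pow_succ]

theorem apolarForm_contractOp (φ f θ : MvPolynomial (Fin 2) ℂ) :
    apolarForm (contractOp φ f) θ = apolarForm f (θ * φ) := by
  conv_rhs => rw [φ.as_sum]
  rw [contractOp, map_sum, LinearMap.sum_apply, Finset.mul_sum, map_sum]
  refine Finset.sum_congr rfl fun m _ => ?_
  rw [map_smul, LinearMap.smul_apply, apolarForm_iterate_pderiv, apolarForm_iterate_pderiv,
    ← map_smul, monomial_eq, Finsupp.prod_fintype _ _ (by simp), Fin.prod_univ_two,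
    smul_eq_C_mul]
  congr 1
  ring

theorem contractOp_eq_zero_iff (φ f : MvPolynomial (Fin 2) ℂ) :
    contractOp φ f = 0 ↔ φ ∈ apolarIdeal (apolarForm f) := by
  rw [← map_eq_zero_iff _ apolarForm_injective, mem_apolarIdeal, LinearMap.ext_iff]
  simp only [apolarForm_contractOp, LinearMap.zero_apply]

theorem concentratedIn_apolarForm {n : ℕ} {f : MvPolynomial (Fin 2) ℂ} (hf : f.IsHomogeneous n) :
    ConcentratedIn (apolarForm f) n := by
  intro θ
  suffices h : apolarForm f ∘ₗ homogeneousComponent n = apolarForm f from LinearMap.congr_fun h θ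
  refine ext_monomial fun a => ?_
  rw [LinearMap.comp_apply,
    homogeneousComponent_of_mem (isHomogeneous_monomial (1 : ℂ) (rfl : a.degree = _))]
  split_ifs with h
  · rfl
  · rw [map_zero, apolarForm_monomial, hf.coeff_eq_zero (fun h' => h h'.symm), mul_zero,
      mul_zero]

open Nat in
theorem ConcentratedIn.exists_apolarForm_eq {Λ : MvPolynomial (Fin 2) ℂ →ₗ[ℂ] ℂ} {n : ℕ}
    (hΛ : ConcentratedIn Λ n) : ∃ f, f.IsHomogeneous n ∧ apolarForm f = Λ := by
  set f : MvPolynomial (Fin 2) ℂ := ∑ a ∈ Finset.univ.finsuppAntidiag n,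
    monomial a (Λ (monomial a 1) / (((a 0)! * (a 1)! : ℕ) : ℂ)) with hf
  have hmem : ∀ a : Fin 2 →₀ ℕ, a ∈ (Finset.univ : Finset (Fin 2)).finsuppAntidiag n ↔
      a.degree = n := fun a => by
    simp [Finset.mem_finsuppAntidiag, Finsupp.degree_eq_sum]
  have hfn : f.IsHomogeneous n :=
    IsHomogeneous.sum _ _ _ fun a ha => isHomogeneous_monomial _ ((hmem a).1 ha)
  refine ⟨f, hfn, ext_monomial fun a => ?_⟩
  by_cases ha : a.degree = n
  · rw [apolarForm_monomial, hf, coeff_sum]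
    simp only [coeff_monomial, Finset.sum_ite_eq', hmem, ha, if_true, one_mul]
    exact mul_div_cancel₀ _ (Nat.cast_ne_zero.2 (by positivity))
  · have h0 : homogeneousComponent n (monomial a (1 : ℂ)) = 0 := by
      rw [homogeneousComponent_of_mem (isHomogeneous_monomial (1 : ℂ) (rfl : a.degree = _)),
        if_neg (fun h => ha h.symm)]
    rw [← hΛ, ← concentratedIn_apolarForm hfn, h0, map_zero, map_zero]

/-- The directional derivative dual to `vanishingForm p`. -/
noncomputable def derivAlong (p : Fin 2 → ℂ) :
    Derivation ℂ (MvPolynomial (Fin 2) ℂ) (MvPolynomial (Fin 2) ℂ) :=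
  p 1 • pderiv 0 - p 0 • pderiv 1

theorem derivAlong_apply (p : Fin 2 → ℂ) (f : MvPolynomial (Fin 2) ℂ) :
    derivAlong p f = C (p 1) * pderiv 0 f - C (p 0) * pderiv 1 f := by
  simp [derivAlong, smul_eq_C_mul]

theorem derivAlong_isHomogeneous {n : ℕ} {f : MvPolynomial (Fin 2) ℂ} (hf : f.IsHomogeneous n)
    (p : Fin 2 → ℂ) : (derivAlong p f).IsHomogeneous (n - 1) := by
  rw [derivAlong_apply]
  exact (hf.pderiv.C_mul _).sub (hf.pderiv.C_mul _)

theorem vanishingForm_mul_mem_apolarIdeal (p : Fin 2 → ℂ) (f φ : MvPolynomial (Fin 2) ℂ) :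
    vanishingForm p * φ ∈ apolarIdeal (apolarForm f) ↔
      φ ∈ apolarIdeal (apolarForm (derivAlong p f)) := by
  refine forall_congr' fun θ => ?_
  rw [derivAlong_apply, ← smul_eq_C_mul, ← smul_eq_C_mul, map_sub, map_smul, map_smul,
    LinearMap.sub_apply, LinearMap.smul_apply, LinearMap.smul_apply, apolarForm_pderiv,
    apolarForm_pderiv, ← map_smul, ← map_smul, ← map_sub, smul_eq_C_mul, smul_eq_C_mul,
    vanishingForm]
  ring_nf

/-- The linear form with coefficient vector `p`. -/
noncomputable def pointForm (p : Fin 2 → ℂ) : MvPolynomial (Fin 2) ℂ :=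
  C (p 0) * X 0 + C (p 1) * X 1

theorem pointForm_isHomogeneous (p : Fin 2 → ℂ) : (pointForm p).IsHomogeneous 1 :=
  (isHomogeneous_C_mul_X _ _).add (isHomogeneous_C_mul_X _ _)

theorem derivAlong_pointForm (p : Fin 2 → ℂ) : derivAlong p (pointForm p) = 0 := by
  rw [derivAlong_apply, pointForm]
  simp
  ring

theorem vanishingForm_pow_mem_apolarIdeal (p : Fin 2 → ℂ) {j g : ℕ}
    {G : MvPolynomial (Fin 2) ℂ} (hG : G.IsHomogeneous j) (hj : j < g) (e : ℕ) :
    vanishingForm p ^ g ∈ apolarIdeal (apolarForm (G * pointForm p ^ e)) := by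
  induction g generalizing j G with
  | zero => omega
  | succ g ih =>
    rw [pow_succ', vanishingForm_mul_mem_apolarIdeal]
    have h : derivAlong p (G * pointForm p ^ e) = derivAlong p G * pointForm p ^ e := by
      rw [Derivation.leibniz, Derivation.leibniz_pow, derivAlong_pointForm]
      simp [mul_comm]
    rw [h]
    rcases j with _ | j
    · rw [← totalDegree_zero_iff_isHomogeneous, totalDegree_eq_zero_iff_eq_C] at hG
      have h0 : derivAlong p G = 0 := by rw [hG, derivAlong_apply]; simp
      rw [h0, zero_mul, map_zero]
      exact fun θ => rfl
    · exact ih (derivAlong_isHomogeneous hG p) (by omega)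

theorem exists_eq_pointForm {L : MvPolynomial (Fin 2) ℂ} (hL : L.IsHomogeneous 1) :
    ∃ p, L = pointForm p := by
  rw [← mem_homogeneousSubmodule, homogeneousSubmodule_one_eq_span_X,
    Submodule.mem_span_range_iff_exists_fun] at hL
  obtain ⟨p, rfl⟩ := hL
  exact ⟨p, by simp [pointForm, smul_eq_C_mul]⟩

theorem HasGADLength.exists_mem_apolarIdeal {n s : ℕ} {f : MvPolynomial (Fin 2) ℂ}
    (h : HasGADLength n f s) :
    ∃ α, α.IsHomogeneous s ∧ α ≠ 0 ∧ α ∈ apolarIdeal (apolarForm f) := by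
  obtain ⟨m, L, g, G, ⟨hL, -, hg, hG, hsum⟩, rfl⟩ := h
  choose p hp using fun i => exists_eq_pointForm (hL i).2
  have hp0 : ∀ i, p i ≠ 0 := fun i h0 => (hL i).1 (by simp [hp i, h0, pointForm])
  refine ⟨∏ i, vanishingForm (p i) ^ g i, IsHomogeneous.prod _ _ _ fun i _ => ?_,
    Finset.prod_ne_zero_iff.2 fun i _ => pow_ne_zero _ (vanishingForm_ne_zero (hp0 i)),
    fun θ => ?_⟩
  · simpa using (vanishingForm_isHomogeneous (p i)).pow (g i)
  · rw [hsum, map_sum, LinearMap.sum_apply]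
    refine Finset.sum_eq_zero fun i hi => ?_
    have hmem := vanishingForm_pow_mem_apolarIdeal (p i) (hG i)
      (by have := hg i; omega : g i - 1 < g i) (n - g i + 1)
    rw [← hp i] at hmem
    exact Ideal.mem_of_dvd _
      (Finset.dvd_prod_of_mem (fun i => vanishingForm (p i) ^ g i) hi) hmem θ

theorem HasGADLength.pos {n s : ℕ} {f : MvPolynomial (Fin 2) ℂ} (h : HasGADLength n f s)
    (hf : f.IsHomogeneous n) (hf0 : f ≠ 0) : 0 < n := by
  rcases Nat.eq_zero_or_pos n with rfl | hn
  · exfalso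
    obtain ⟨m, L, g, G, ⟨hL, -, -, -, hsum⟩, -⟩ := h
    have hc : f = C (constantCoeff f) := by
      rwa [← totalDegree_zero_iff_isHomogeneous, totalDegree_eq_zero_iff_eq_C] at hf
    refine hf0 ?_
    rw [hc, hsum, map_sum, Finset.sum_eq_zero, C_0]
    intro i _
    obtain ⟨p, hp⟩ := exists_eq_pointForm (hL i).2
    simp [hp, pointForm]
  · exact hn

theorem pointForm_pow_dvd {p : Fin 2 → ℂ} (hp : p ≠ 0) {n g : ℕ} {f : MvPolynomial (Fin 2) ℂ}
    (hf : f.IsHomogeneous n) (h : vanishingForm p ^ g ∈ apolarIdeal (apolarForm f)) :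
    pointForm p ^ (n + 1 - g) ∣ f := by
  induction n generalizing f g with
  | zero =>
    rcases g with _ | g
    · rw [pow_zero] at h
      rw [(map_eq_zero_iff _ apolarForm_injective).1 (eq_zero_of_one_mem_apolarIdeal h)]
      exact dvd_zero _
    · rw [show 0 + 1 - (g + 1) = 0 by omega, pow_zero]
      exact one_dvd _
  | succ n ih =>
    rcases g with _ | g
    · rw [pow_zero] at h
      rw [(map_eq_zero_iff _ apolarForm_injective).1 (eq_zero_of_one_mem_apolarIdeal h)]
      exact dvd_zero _
    · have h1 : pointForm p ^ (n + 1 - g) ∣ derivAlong p f := by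
        refine ih (derivAlong_isHomogeneous hf p) ?_
        rwa [pow_succ', vanishingForm_mul_mem_apolarIdeal] at h
      have h2 : ∀ i, pointForm p ^ (n + 1 - g) ∣ pointForm p * pderiv i f := by
        intro i
        have h3 : pointForm p ^ (n + 1 - (g + 1)) ∣ pderiv i f := by
          refine ih hf.pderiv fun θ => ?_
          rw [apolarForm_pderiv, mul_right_comm]
          exact h _
        refine (pow_dvd_pow _ (by omega : n + 1 - g ≤ n + 1 - (g + 1) + 1)).trans ?_
        rw [pow_succ']
        exact mul_dvd_mul_left _ h3
      have heuler := hf.sum_X_mul_pderiv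
      rw [Fin.sum_univ_two, nsmul_eq_mul] at heuler
      rw [show n + 1 + 1 - (g + 1) = n + 1 - g by omega]
      have hcancel : ∀ c : ℂ, c ≠ 0 →
          pointForm p ^ (n + 1 - g) ∣ C c * (((n + 1 : ℕ) : MvPolynomial (Fin 2) ℂ) * f) →
          pointForm p ^ (n + 1 - g) ∣ f := by
        intro c hc hd
        have hu : IsUnit (C (c * ((n + 1 : ℕ) : ℂ)) : MvPolynomial (Fin 2) ℂ) :=
          (isUnit_iff_ne_zero.2 (mul_ne_zero hc (Nat.cast_ne_zero.2 n.succ_ne_zero))).map C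
        rwa [← mul_assoc, ← map_natCast (C : ℂ →+* MvPolynomial (Fin 2) ℂ), ← C_mul,
          hu.dvd_mul_left] at hd
      obtain ⟨i, hi⟩ : ∃ i, p i ≠ 0 := Function.ne_iff.1 hp
      refine hcancel (p i) hi ?_
      fin_cases i
      · have h4 : C (p 0) * (((n + 1 : ℕ) : MvPolynomial (Fin 2) ℂ) * f) =
            pointForm p * pderiv 0 f - X 1 * derivAlong p f := by
          rw [← heuler, pointForm, derivAlong_apply]
          ring
        exact h4 ▸ dvd_sub (h2 0) (h1.mul_left _)
      · have h4 : C (p 1) * (((n + 1 : ℕ) : MvPolynomial (Fin 2) ℂ) * f) =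
            pointForm p * pderiv 1 f + X 0 * derivAlong p f := by
          rw [← heuler, pointForm, derivAlong_apply]
          ring
        exact h4 ▸ dvd_add (h2 1) (h1.mul_left _)

theorem exists_sum_eq_of_prod_mem_apolarIdeal {ι : Type*} [Fintype ι]
    {P : ι → MvPolynomial (Fin 2) ℂ} (hP : Pairwise (Function.onFun IsRelPrime P))
    {Λ : MvPolynomial (Fin 2) ℂ →ₗ[ℂ] ℂ} (h : ∏ i, P i ∈ apolarIdeal Λ) :
    ∃ M : ι → MvPolynomial (Fin 2) ℂ →ₗ[ℂ] ℂ, ∑ i, M i = Λ ∧ ∀ i, P i ∈ apolarIdeal (M i) := by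
  set U : ι → Submodule ℂ (MvPolynomial (Fin 2) ℂ) := fun i =>
    (Ideal.span {P i}).restrictScalars ℂ with hU
  have hΛ : Λ ∈ Submodule.dualAnnihilator (⨅ i, U i) := by
    rw [Submodule.mem_dualAnnihilator]
    intro w hw
    have hd : ∀ i, P i ∣ w := fun i =>
      Ideal.mem_span_singleton.1 ((Submodule.mem_iInf _).1 hw i)
    obtain ⟨v, rfl⟩ := Fintype.prod_dvd_of_isRelPrime hP hd
    rw [mul_comm]
    exact h v
  rw [Subspace.dualAnnihilator_iInf_eq, Submodule.mem_iSup_iff_exists_finsupp] at hΛ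
  obtain ⟨M, hM, hsum⟩ := hΛ
  refine ⟨M, by rw [← hsum, Finsupp.sum_fintype _ _ fun _ => rfl], fun i θ => ?_⟩
  exact (Submodule.mem_dualAnnihilator _).1 (hM i) _
    (Ideal.mem_span_singleton.2 (dvd_mul_left _ _) : θ * P i ∈ Ideal.span {P i})

theorem mem_apolarIdeal_comp_homogeneousComponent {Λ : MvPolynomial (Fin 2) ℂ →ₗ[ℂ] ℂ} {k : ℕ}
    {φ : MvPolynomial (Fin 2) ℂ} (hφ : φ.IsHomogeneous k) (h : φ ∈ apolarIdeal Λ) (n : ℕ) :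
    φ ∈ apolarIdeal (Λ ∘ₗ homogeneousComponent n) := by
  intro θ
  rw [LinearMap.comp_apply, mul_comm, homogeneousComponent_mul_of_left hφ]
  split_ifs
  · rw [mul_comm]
    exact h _
  · exact map_zero _

theorem concentratedIn_comp_homogeneousComponent (Λ : MvPolynomial (Fin 2) ℂ →ₗ[ℂ] ℂ) (n : ℕ) :
    ConcentratedIn (Λ ∘ₗ homogeneousComponent n) n := by
  intro θ
  rw [LinearMap.comp_apply, LinearMap.comp_apply,
    homogeneousComponent_eq_self (homogeneousComponent_isHomogeneous n θ)]

theorem exists_sum_eq_of_prod_pow_mem_apolarIdeal {ι : Type*} [Fintype ι] {n : ℕ}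
    {P : ι → MvPolynomial (Fin 2) ℂ} (hP : Pairwise (Function.onFun IsRelPrime P)) {g : ι → ℕ}
    (hPg : ∀ i, (P i).IsHomogeneous (g i)) {f : MvPolynomial (Fin 2) ℂ} (hf : f.IsHomogeneous n)
    (h : ∏ i, P i ∈ apolarIdeal (apolarForm f)) :
    ∃ F : ι → MvPolynomial (Fin 2) ℂ, ∑ i, F i = f ∧
      ∀ i, (F i).IsHomogeneous n ∧ P i ∈ apolarIdeal (apolarForm (F i)) := by
  obtain ⟨M, hM, hPM⟩ := exists_sum_eq_of_prod_mem_apolarIdeal hP h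
  choose F hF hFM using fun i =>
    (concentratedIn_comp_homogeneousComponent (M i) n).exists_apolarForm_eq
  refine ⟨F, apolarForm_injective (LinearMap.ext fun θ => ?_), fun i => ⟨hF i, ?_⟩⟩
  · rw [map_sum, LinearMap.sum_apply, ← concentratedIn_apolarForm hf, ← hM, LinearMap.sum_apply]
    exact Finset.sum_congr rfl fun i _ => by rw [hFM, LinearMap.comp_apply]
  · rw [hFM]
    exact mem_apolarIdeal_comp_homogeneousComponent (hPg i) (hPM i) n

theorem isRelPrime_vanishingForm {p q : Fin 2 → ℂ} (h : p 1 * q 0 - p 0 * q 1 ≠ 0) :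
    IsRelPrime (vanishingForm p) (vanishingForm q) := by
  have hp : vanishingForm p ≠ 0 := by
    intro h0
    apply h
    rw [← eval_vanishingForm, h0, map_zero]
  have hirr : Irreducible (vanishingForm p) := by
    refine irreducible_of_totalDegree_eq_one ((vanishingForm_isHomogeneous p).totalDegree hp) ?_
    intro x hx
    rw [isUnit_iff_ne_zero]
    rintro rfl
    exact hp (MvPolynomial.ext _ _ fun i => zero_dvd_iff.1 (hx i))
  rw [hirr.isRelPrime_iff_not_dvd]
  intro hd
  have h1 := map_dvd (eval p) hd
  rw [eval_vanishingForm, eval_vanishingForm, mul_comm, sub_self, zero_dvd_iff] at h1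
  exact h (by linear_combination -h1)

/-- The chosen representatives of the points of the projective line. -/
def IsNormalized (p : Fin 2 → ℂ) : Prop := p = ![1, 0] ∨ ∃ a, p = ![a, 1]

theorem IsNormalized.ne_zero {p : Fin 2 → ℂ} (hp : IsNormalized p) : p ≠ 0 := by
  rintro rfl
  rcases hp with h | ⟨a, h⟩
  · simpa using congrFun h 0
  · simpa using congrFun h 1

theorem IsNormalized.eq_of_det_eq_zero {p q : Fin 2 → ℂ} (hp : IsNormalized p)
    (hq : IsNormalized q) (h : p 1 * q 0 - p 0 * q 1 = 0) : p = q := by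
  rcases hp with rfl | ⟨a, rfl⟩ <;> rcases hq with rfl | ⟨b, rfl⟩ <;> simp at h ⊢
  linear_combination -h

theorem exists_dvd_prod_vanishingForm {k : ℕ} {φ : MvPolynomial (Fin 2) ℂ}
    (hφ : φ.IsHomogeneous k) (hφ0 : φ ≠ 0) :
    ∃ M : Multiset (Fin 2 → ℂ), (∀ p ∈ M, IsNormalized p) ∧ M.card = k ∧
      φ ∣ (M.map vanishingForm).prod := by
  induction k generalizing φ with
  | zero => exact ⟨0, by simp, rfl, (isUnit_of_isHomogeneous_zero hφ hφ0).dvd⟩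
  | succ k ih =>
    obtain ⟨p, hp, h⟩ := exists_eval_eq_zero_s11 hφ
    have hp' : IsNormalized p := hp
    obtain ⟨ψ, hψ, rfl⟩ := exists_eq_vanishingForm_mul hφ hp'.ne_zero h
    obtain ⟨M, hM, hcard, hd⟩ := ih hψ (right_ne_zero_of_mul hφ0)
    refine ⟨p ::ₘ M, fun q hq => ?_, by rw [Multiset.card_cons, hcard], ?_⟩
    · rcases Multiset.mem_cons.1 hq with rfl | hq
      · exact hp'
      · exact hM q hq
    · rw [Multiset.map_cons, Multiset.prod_cons]
      exact mul_dvd_mul_left _ hd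

theorem exists_dvd_prod_vanishingForm_pow {k : ℕ} {φ : MvPolynomial (Fin 2) ℂ}
    (hφ : φ.IsHomogeneous k) (hφ0 : φ ≠ 0) :
    ∃ (m : ℕ) (p : Fin m → Fin 2 → ℂ) (g : Fin m → ℕ), (∀ i, p i ≠ 0) ∧
      (∀ i j, i ≠ j → p i 1 * p j 0 - p i 0 * p j 1 ≠ 0) ∧ (∀ i, 1 ≤ g i) ∧ ∑ i, g i = k ∧
      φ ∣ ∏ i, vanishingForm (p i) ^ g i := by
  obtain ⟨M, hM, hcard, hd⟩ := exists_dvd_prod_vanishingForm hφ hφ0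
  set e := M.toFinset.equivFin.symm
  have hmem : ∀ i, (e i : Fin 2 → ℂ) ∈ M := fun i => Multiset.mem_toFinset.1 (e i).2
  refine ⟨_, fun i => e i, fun i => M.count (e i : Fin 2 → ℂ), fun i => (hM _ (hmem i)).ne_zero,
    fun i j hij h => hij ?_, fun i => Multiset.one_le_count_iff_mem.2 (hmem i), ?_, ?_⟩
  · exact e.injective (Subtype.ext
      ((hM _ (hmem i)).eq_of_det_eq_zero (hM _ (hmem j)) h))
  · rw [e.sum_comp fun q : M.toFinset => M.count (q : Fin 2 → ℂ),
      Finset.sum_coe_sort M.toFinset fun q => M.count q, Multiset.toFinset_sum_count_eq, hcard]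
  · rwa [e.prod_comp fun q : M.toFinset => vanishingForm q ^ M.count (q : Fin 2 → ℂ),
      Finset.prod_coe_sort M.toFinset fun q => vanishingForm q ^ M.count q,
      ← Finset.prod_multiset_map_count]

theorem not_proportional_pointForm {p q : Fin 2 → ℂ} (h : p 1 * q 0 - p 0 * q 1 ≠ 0) :
    ¬ Proportional (pointForm p) (pointForm q) := by
  rintro ⟨c, hc⟩
  have h0 := congrArg (eval ![1, 0]) hc
  have h1 := congrArg (eval ![0, 1]) hc
  simp [pointForm, smul_eq_C_mul] at h0 h1
  exact h (by rw [h0, h1]; ring)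

theorem pointForm_ne_zero {p : Fin 2 → ℂ} (hp : p ≠ 0) : pointForm p ≠ 0 := by
  intro h
  apply hp
  have h0 := congrArg (eval ![1, 0]) h
  have h1 := congrArg (eval ![0, 1]) h
  simp [pointForm] at h0 h1
  ext i
  fin_cases i <;> simp [h0, h1]

theorem hasGADLength_of_mem_apolarIdeal {n k : ℕ} {f φ : MvPolynomial (Fin 2) ℂ}
    (hf : f.IsHomogeneous n) (hφ : φ.IsHomogeneous k) (hφ0 : φ ≠ 0) (hk : k ≤ n)
    (h : φ ∈ apolarIdeal (apolarForm f)) : HasGADLength n f k := by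
  obtain ⟨m, p, g, hp, hdet, hg, hsum, hd⟩ := exists_dvd_prod_vanishingForm_pow hφ hφ0
  have hgn : ∀ i, g i ≤ n := fun i =>
    ((Finset.single_le_sum (fun _ _ => Nat.zero_le _) (Finset.mem_univ i)).trans hsum.le).trans hk
  obtain ⟨F, hFsum, hF⟩ := exists_sum_eq_of_prod_pow_mem_apolarIdeal
    (P := fun i => vanishingForm (p i) ^ g i)
    (fun i j hij => (isRelPrime_vanishingForm (hdet i j hij)).pow)
    (fun i => by simpa using (vanishingForm_isHomogeneous (p i)).pow (g i)) hf
    (Ideal.mem_of_dvd _ hd h)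
  choose G hG using fun i => pointForm_pow_dvd (hp i) (hF i).1 (hF i).2
  refine ⟨m, fun i => pointForm (p i), g, G, ⟨fun i => ⟨pointForm_ne_zero (hp i),
    pointForm_isHomogeneous _⟩, fun i j hij => not_proportional_pointForm (hdet i j hij), hg,
    fun i => ?_, ?_⟩, hsum⟩
  · refine isHomogeneous_of_mul_left (i := n + 1 - g i)
      (by simpa using (pointForm_isHomogeneous (p i)).pow (n + 1 - g i))
      (pow_ne_zero _ (pointForm_ne_zero (hp i))) ?_
    rw [← hG i, show n + 1 - g i + (g i - 1) = n by have := hg i; have := hgn i; omega]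
    exact (hF i).1
  · rw [← hFsum]
    refine Finset.sum_congr rfl fun i _ => ?_
    rw [hG i, mul_comm, show n - g i + 1 = n + 1 - g i by have := hgn i; omega]

theorem apolar_complete_intersection (n s : ℕ)
    (f : MvPolynomial (Fin 2) ℂ) (hf0 : f ≠ 0) (hf : f.IsHomogeneous n)
    (hlen : IsLeast {l | HasGADLength n f l} s) :
    ∃ α β : MvPolynomial (Fin 2) ℂ,
      α.IsHomogeneous s ∧ β.IsHomogeneous (n + 2 - s) ∧
      contractOp α f = 0 ∧ contractOp β f = 0 ∧
      (∀ φ : MvPolynomial (Fin 2) ℂ, contractOp φ f = 0 ↔ φ ∈ Ideal.span {α, β}) ∧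
      (∀ p : Fin 2 → ℂ, p ≠ 0 → ¬ (MvPolynomial.eval p α = 0 ∧ MvPolynomial.eval p β = 0)) := by
  have hn : 0 < n := HasGADLength.pos hlen.1 hf hf0
  have hΛ := concentratedIn_apolarForm hf
  have hΛ0 : apolarForm f ≠ 0 := (map_ne_zero_iff _ apolarForm_injective).2 hf0
  obtain ⟨α, hα, hα0, hαΛ⟩ := HasGADLength.exists_mem_apolarIdeal hlen.1
  have hle : ∀ {k φ}, k ≤ n → φ.IsHomogeneous k → φ ≠ 0 → φ ∈ apolarIdeal (apolarForm f) →
      s ≤ k := fun hk hφ hφ0 hφΛ => hlen.2 (hasGADLength_of_mem_apolarIdeal hf hφ hφ0 hk hφΛ)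
  have hsn : s ≤ n := by
    obtain ⟨φ, hφ, hφ0, hφΛ⟩ := hΛ.exists_mem_apolarIdeal (by omega : n < 2 * n)
    exact hle le_rfl hφ hφ0 hφΛ
  have hs : NoApolarBelow (apolarForm f) s := by
    intro j φ hj hφ hφΛ
    by_contra hφ0
    exact absurd (hle (by omega) hφ hφ0 hφΛ) (by omega)
  obtain ⟨β, hβ, hspan, hz⟩ := hΛ.exists_generators hΛ0 hα hα0 hαΛ hs
  have hiff : ∀ φ, contractOp φ f = 0 ↔ φ ∈ Ideal.span {α, β} := fun φ => by
    rw [contractOp_eq_zero_iff, hspan]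
  exact ⟨α, β, hα, hβ, (hiff α).2 (Ideal.subset_span (by simp)),
    (hiff β).2 (Ideal.subset_span (by simp)), hiff, hz⟩
end
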